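/- For every nonnegative integer n, a̅₅(20n+14) = 10·c₅(10n+6). -/

import Mathlib

open scoped BigOperators

/-- The q-Pochhammer infinite product `(a; q)_∞ = ∏_{k≥0} (1 - a q^k)`. -/
noncomputable def qpoch (a q : ℂ) : ℂ := ∏' k : ℕ, (1 - a * q ^ k)

/-- `φ(-q) = (q;q)_∞² / (q²;q²)_∞`. -/
noncomputable def phiNeg (q : ℂ) : ℂ := qpoch q q ^ 2 / qpoch (q ^ 2) (q ^ 2)

/-- `ψ(-q) = (q;q)_∞ (q⁴;q⁴)_∞ / (q²;q²)_∞`. -/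
noncomputable def psiNeg (q : ℂ) : ℂ :=
  qpoch q q * qpoch (q ^ 4) (q ^ 4) / qpoch (q ^ 2) (q ^ 2)

/-! ### Basic facts on infinite products -/

lemma qp_summable (a : ℂ) {q : ℂ} (hq : ‖q‖ < 1) : Summable (fun k : ℕ => ‖-(a * q ^ k)‖) := by
  simp only [norm_neg, norm_mul, norm_pow]
  exact (summable_geometric_of_lt_one (norm_nonneg _) hq).mul_left _

lemma qp_mult (a : ℂ) {q : ℂ} (hq : ‖q‖ < 1) : Multipliable (fun k : ℕ => 1 - a * q ^ k) := by
  simpa [sub_eq_add_neg] using multipliable_one_add_of_summable (qp_summable a hq)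

lemma qp_ne_zero (a : ℂ) {q : ℂ} (hq : ‖q‖ < 1) (h : ∀ k : ℕ, 1 - a * q ^ k ≠ 0) :
    qpoch a q ≠ 0 := by
  have := tprod_one_add_ne_zero_of_summable (f := fun k : ℕ => -(a * q ^ k))
    (by intro i; simpa [sub_eq_add_neg] using h i) (qp_summable a hq)
  simpa [qpoch, sub_eq_add_neg] using this

lemma qp_ne_zero' {a q : ℂ} (ha : ‖a‖ < 1) (hq : ‖q‖ < 1) : qpoch a q ≠ 0 := by
  apply qp_ne_zero a hq
  intro k h
  have h1 : a * q ^ k = 1 := by linear_combination -h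
  have h2 : ‖a * q ^ k‖ < 1 := by
    rw [norm_mul, norm_pow]
    calc ‖a‖ * ‖q‖ ^ k ≤ ‖a‖ * 1 := by
          gcongr
          exact pow_le_one₀ (norm_nonneg _) hq.le
      _ < 1 := by simpa using ha
  rw [h1] at h2
  simp at h2

lemma qp_succ (a : ℂ) {q : ℂ} (hq : ‖q‖ < 1) : qpoch a q = (1 - a) * qpoch (a * q) q := by
  unfold qpoch
  rw [tprod_eq_zero_mul']
  · simp [pow_succ', mul_assoc]
  · simpa [pow_succ', mul_assoc] using qp_mult (a * q) hq

lemma norm_pow_lt {q : ℂ} (hq : ‖q‖ < 1) {m : ℕ} (hm : m ≠ 0) : ‖q ^ m‖ < 1 := by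
  rw [norm_pow]
  exact pow_lt_one₀ (norm_nonneg _) hq hm

lemma qp_split (a : ℂ) {q : ℂ} (hq : ‖q‖ < 1) (m : ℕ) [NeZero m] :
    qpoch a q = ∏ j ∈ Finset.range m, qpoch (a * q ^ j) (q ^ m) := by
  have hm := qp_mult a hq
  have e := ((Nat.divModEquiv m).trans (Equiv.prodComm _ _)).symm
  have key : ∏' p : Fin m × ℕ, (1 - a * q ^ (((Nat.divModEquiv m).trans (Equiv.prodComm _ _)).symm p))
      = qpoch a q := Equiv.tprod_eq ((Nat.divModEquiv m).trans (Equiv.prodComm _ _)).symm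
        (fun k : ℕ => 1 - a * q ^ k)
  have hmm : Multipliable (fun p : Fin m × ℕ =>
      (1 - a * q ^ (((Nat.divModEquiv m).trans (Equiv.prodComm _ _)).symm p))) :=
    (Equiv.multipliable_iff ((Nat.divModEquiv m).trans (Equiv.prodComm _ _)).symm
      (f := fun k : ℕ => 1 - a * q ^ k)).2 hm
  have fac : ∀ (j : Fin m) (k : ℕ),
      (1 - a * q ^ (((Nat.divModEquiv m).trans (Equiv.prodComm _ _)).symm (j, k)))
        = 1 - (a * q ^ (j : ℕ)) * (q ^ m) ^ k := by
    intro j k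
    simp [Nat.divModEquiv]
    rw [pow_add, pow_mul']
    ring
  rw [← key, hmm.tprod_prod']
  · rw [tprod_fintype, ← Fin.prod_univ_eq_prod_range (fun j => qpoch (a * q ^ j) (q ^ m)) m]
    refine Finset.prod_congr rfl fun j _ => ?_
    unfold qpoch
    exact tprod_congr (fac j)
  · intro j
    have := qp_mult (a * q ^ (j : ℕ)) (norm_pow_lt hq (NeZero.ne m))
    refine this.congr ?_
    intro k
    exact (fac j k).symm

lemma qp_mul_neg (a : ℂ) {q : ℂ} (hq : ‖q‖ < 1) :
    qpoch a q * qpoch (-a) q = qpoch (a ^ 2) (q ^ 2) := by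
  unfold qpoch
  rw [← (qp_mult a hq).tprod_mul (qp_mult (-a) hq)]
  refine tprod_congr fun k => ?_
  ring

lemma qp_five (a z : ℂ) {q : ℂ} (hq : ‖q‖ < 1) (hz : 1 + z + z ^ 2 + z ^ 3 + z ^ 4 = 0) :
    qpoch a q * qpoch (z * a) q * qpoch (z ^ 2 * a) q * qpoch (z ^ 3 * a) q * qpoch (z ^ 4 * a) q
      = qpoch (a ^ 5) (q ^ 5) := by
  unfold qpoch
  have h0 := qp_mult a hq
  have h1 := qp_mult (z * a) hq
  have h2 := qp_mult (z ^ 2 * a) hq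
  have h3 := qp_mult (z ^ 3 * a) hq
  have h4 := qp_mult (z ^ 4 * a) hq
  rw [← h0.tprod_mul h1, ← (h0.mul h1).tprod_mul h2, ← ((h0.mul h1).mul h2).tprod_mul h3,
    ← (((h0.mul h1).mul h2).mul h3).tprod_mul h4]
  refine tprod_congr fun k => ?_
  have e : (a ^ 5 * (q ^ 5) ^ k) = (a * q ^ k) ^ 5 := by ring
  rw [e]
  simp only [mul_assoc]
  generalize a * q ^ k = x
  have h5 : z ^ 5 = 1 := by linear_combination (z - 1) * hz
  have h4 : z ^ 4 = -1 - z - z ^ 2 - z ^ 3 := by linear_combination hz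
  grind

/-! ### The Jacobi triple product -/

/-- Triangular numbers on the integers. -/
def tri (j : ℤ) : ℤ := j * (j - 1) / 2

lemma two_tri (j : ℤ) : 2 * tri j = j * (j - 1) := by
  unfold tri
  have : Even (j * (j - 1)) := Int.even_mul_pred_self j
  exact Int.two_mul_ediv_two_of_even this

lemma tri_add_one (j : ℤ) : tri (j + 1) = tri j + j := by
  have h1 := two_tri j
  have h2 := two_tri (j + 1)
  have : 2 * tri (j + 1) = 2 * (tri j + j) := by linear_combination h2 - h1
  omega

lemma tri_neg (j : ℤ) : tri (-j) = tri j + j := by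
  have h1 := two_tri j
  have h2 := two_tri (-j)
  have : 2 * tri (-j) = 2 * (tri j + j) := by linear_combination h2 - h1
  omega

lemma tri_zero : tri 0 = 0 := by simp [tri]

/-- The general theta series. -/
noncomputable def th (a Q : ℂ) : ℂ := ∑' j : ℤ, a ^ j * Q ^ tri j

lemma th_summable_nat (a : ℂ) {Q : ℂ} (ha : a ≠ 0) (hQ0 : Q ≠ 0) (hQ : ‖Q‖ < 1) :
    Summable (fun j : ℕ => a ^ (j : ℤ) * Q ^ tri j) := by
  apply summable_of_ratio_test_tendsto_lt_one (l := 0) one_pos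
  · filter_upwards with n
    exact mul_ne_zero (zpow_ne_zero _ ha) (zpow_ne_zero _ hQ0)
  · have : ∀ n : ℕ, ‖a ^ ((n + 1 : ℕ) : ℤ) * Q ^ tri ((n + 1 : ℕ) : ℤ)‖ / ‖a ^ (n : ℤ) * Q ^ tri n‖
        = ‖a‖ * ‖Q‖ ^ n := by
      intro n
      rw [← norm_div, Nat.cast_succ, tri_add_one, zpow_add₀ hQ0, zpow_add_one₀ ha, ← norm_pow,
        ← norm_mul]
      congr 1
      have h1 : a ^ (n : ℤ) ≠ 0 := zpow_ne_zero _ ha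
      have h2 : Q ^ tri n ≠ 0 := zpow_ne_zero _ hQ0
      rw [zpow_natCast Q n]
      field_simp
    simp_rw [this]
    simpa using (tendsto_pow_atTop_nhds_zero_of_lt_one (norm_nonneg Q) hQ).const_mul ‖a‖

lemma th_summable {a Q : ℂ} (ha : a ≠ 0) (hQ0 : Q ≠ 0) (hQ : ‖Q‖ < 1) :
    Summable (fun j : ℤ => a ^ j * Q ^ tri j) := by
  apply Summable.of_nat_of_neg
  · exact th_summable_nat a ha hQ0 hQ
  · refine (th_summable_nat (Q / a) (div_ne_zero hQ0 ha) hQ0 hQ).congr fun j => ?_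
    rw [tri_neg, zpow_add₀ hQ0, div_zpow, zpow_neg]
    field_simp

/-- Gaussian binomial coefficients. -/
noncomputable def gb (Q : ℂ) : ℕ → ℕ → ℂ
  | _, 0 => 1
  | 0, _ + 1 => 0
  | n + 1, k + 1 => gb Q n k + Q ^ (k + 1) * gb Q n (k + 1)

/-- Finite product `(Q;Q)_m`. -/
noncomputable def pp (Q : ℂ) (m : ℕ) : ℂ := ∏ i ∈ Finset.range m, (1 - Q ^ (i + 1))

lemma gb_zero (Q : ℂ) (n : ℕ) : gb Q n 0 = 1 := by cases n <;> simp [gb]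

lemma gb_gt (Q : ℂ) : ∀ (n k : ℕ), n < k → gb Q n k = 0
  | 0, 0, h => by omega
  | 0, k + 1, _ => by simp [gb]
  | n + 1, 0, h => by omega
  | n + 1, k + 1, h => by
    rw [gb, gb_gt Q n k (by omega), gb_gt Q n (k + 1) (by omega)]
    simp

lemma pp_succ (Q : ℂ) (m : ℕ) : pp Q (m + 1) = pp Q m * (1 - Q ^ (m + 1)) := by
  simp [pp, Finset.prod_range_succ]

lemma gb_pp (Q : ℂ) : ∀ (N i m : ℕ), i + m = N → gb Q N i * pp Q i * pp Q m = pp Q N := by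
  intro N
  induction N with
  | zero =>
    intro i m h
    obtain rfl : i = 0 := by omega
    obtain rfl : m = 0 := by omega
    simp [gb, pp]
  | succ N ih =>
    intro i m h
    rcases i with _ | i
    · obtain rfl : m = N + 1 := by omega
      simp [gb_zero, pp]
    · rcases m with _ | m
      · obtain rfl : i = N := by omega
        have := ih i 0 (by omega)
        rw [gb, gb_gt Q i (i + 1) (by omega), pp_succ]
        linear_combination (1 - Q ^ (i + 1)) * this
      · have h1 := ih i (m + 1) (by omega)
        have h2 := ih (i + 1) m (by omega)
        obtain rfl : N = i + m + 1 := by omega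
        rw [pp_succ] at h1 h2 ⊢
        rw [gb, pp_succ Q m, pp_succ Q (i + m + 1)]
        rw [pp_succ Q (i + m)] at h1 h2 ⊢
        linear_combination (1 - Q ^ (i + 1)) * h1 + Q ^ (i + 1) * (1 - Q ^ (m + 1)) * h2

lemma qbinom (Q : ℂ) (N : ℕ) : ∀ x : ℂ, ∏ k ∈ Finset.range N, (1 + x * Q ^ k) =
    ∑ i ∈ Finset.range (N + 1), gb Q N i * Q ^ (i.choose 2) * x ^ i := by
  induction N with
  | zero => intro x; simp [gb]
  | succ N ih =>
    intro x
    rw [Finset.prod_range_succ']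
    have e : ∀ k ∈ Finset.range N, (1 + x * Q ^ (k + 1)) = (1 + (x * Q) * Q ^ k) := by
      intro k _; ring
    rw [Finset.prod_congr rfl e, ih (x * Q), Finset.sum_range_succ' _ (N + 1)]
    have ch : ∀ i : ℕ, (i + 1).choose 2 = i.choose 2 + i := by
      intro i
      rw [Nat.choose_succ_succ' i 1]
      simp [add_comm]
    have e1 : ∀ i ∈ Finset.range (N + 1), gb Q (N + 1) (i + 1) * Q ^ ((i + 1).choose 2) * x ^ (i + 1)
        = x * (gb Q N i * Q ^ (i.choose 2) * (x * Q) ^ i)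
          + gb Q N (i + 1) * Q ^ ((i + 1).choose 2) * (x * Q) ^ (i + 1) := by
      intro i _
      rw [gb, ch]
      ring
    rw [Finset.sum_congr rfl e1, Finset.sum_add_distrib, ← Finset.mul_sum]
    have e2 := Finset.sum_range_succ' (fun i => gb Q N i * Q ^ (i.choose 2) * (x * Q) ^ i) (N + 1)
    have e3 := Finset.sum_range_succ (fun i => gb Q N i * Q ^ (i.choose 2) * (x * Q) ^ i) (N + 1)
    rw [gb_gt Q N (N + 1) (by omega)] at e3
    simp only [gb_zero] at e2 ⊢
    simp at e2 e3 ⊢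
    linear_combination e2 - e3

lemma fin_prefactor {a Q : ℂ} (hQ0 : Q ≠ 0) (n : ℕ) :
    ∏ l ∈ Finset.range n, (a * (Q ^ (l + 1))⁻¹) = a ^ n * Q ^ (-tri (n + 1)) := by
  induction n with
  | zero => simp [tri]
  | succ n ih =>
    rw [Finset.prod_range_succ, ih]
    push_cast
    rw [tri_add_one (n + 1 : ℤ), neg_add, zpow_add₀ hQ0, zpow_neg Q ((n : ℤ) + 1)]
    norm_cast
    ring

lemma fin_jtp {a Q : ℂ} (ha : a ≠ 0) (hQ0 : Q ≠ 0) (n : ℕ) :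
    (∏ l ∈ Finset.range n, (1 + a * Q ^ l)) * (∏ l ∈ Finset.range n, (1 + Q / a * Q ^ l)) =
    ∑ i ∈ Finset.range (2 * n + 1), gb Q (2 * n) i * (a ^ ((i : ℤ) - n) * Q ^ tri ((i : ℤ) - n)) := by
  have h := qbinom Q (2 * n) (a * (Q ^ n)⁻¹)
  rw [two_mul, Finset.prod_range_add] at h
  have hQn : Q ^ n ≠ 0 := pow_ne_zero _ hQ0
  have e2 : ∏ x ∈ Finset.range n, (1 + a * (Q ^ n)⁻¹ * Q ^ (n + x))
      = ∏ l ∈ Finset.range n, (1 + a * Q ^ l) := by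
    refine Finset.prod_congr rfl fun x _ => ?_
    rw [pow_add]; field_simp
  have e1 : ∏ x ∈ Finset.range n, (1 + a * (Q ^ n)⁻¹ * Q ^ x)
      = (a ^ n * Q ^ (-tri (n + 1))) * ∏ l ∈ Finset.range n, (1 + Q / a * Q ^ l) := by
    rw [← fin_prefactor hQ0, ← Finset.prod_mul_distrib, ← Finset.prod_range_reflect]
    refine Finset.prod_congr rfl fun x hx => ?_
    have hx' : x < n := Finset.mem_range.1 hx
    have hn : Q ^ n = Q ^ (n - 1 - x) * Q ^ (x + 1) := by
      rw [← pow_add]; congr 1; omega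
    rw [hn]
    have := pow_ne_zero (n - 1 - x) hQ0
    have := pow_ne_zero (x) hQ0
    field_simp
    ring
  rw [e1, e2] at h
  have hpre : a ^ n * Q ^ (-tri (n + 1)) ≠ 0 :=
    mul_ne_zero (pow_ne_zero _ ha) (zpow_ne_zero _ hQ0)
  apply mul_left_cancel₀ hpre
  rw [Finset.mul_sum]
  calc _ = _ := by ring
    _ = _ := h
    _ = _ := by
      rw [two_mul]
      refine Finset.sum_congr rfl fun i _ => ?_
      have c : ((i.choose 2 : ℕ) : ℤ) = tri i := by
        have := two_tri i
        have h2 : 2 * i.choose 2 = i * (i - 1) := by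
          rw [Nat.choose_two_right]
          exact Nat.two_mul_div_two_of_even (Nat.even_mul_pred_self i)
        rcases i with _ | i
        · simp [tri]
        · rw [Nat.add_sub_cancel] at h2
          have h2 : (2 : ℤ) * (((i + 1).choose 2 : ℕ) : ℤ) = (i + 1) * i := by exact_mod_cast h2
          push_cast at this ⊢
          have : 2 * (((i + 1).choose 2 : ℕ) : ℤ) = 2 * tri (i + 1) := by
            rw [this, h2]; ring
          omega
      have l1 : (Q : ℂ) ^ (i.choose 2) = Q ^ tri i := by rw [← c, zpow_natCast]
      have l2 : (a * (Q ^ n)⁻¹) ^ i = a ^ n * a ^ ((i : ℤ) - n) * Q ^ (-(n * i : ℤ)) := by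
        rw [zpow_sub₀ ha, zpow_neg]
        norm_cast
        rw [mul_pow, inv_pow, ← pow_mul]
        field_simp
      have l3 : tri i + -(n * i : ℤ) = -tri (n + 1) + tri ((i : ℤ) - n) := by
        have := two_tri i
        have := two_tri (n + 1 : ℤ)
        have := two_tri ((i : ℤ) - n)
        have : 2 * (tri i + -(n * i : ℤ)) = 2 * (-tri (n + 1) + tri ((i : ℤ) - n)) := by
          linarith
        omega
      rw [l1, l2]
      calc _ = gb Q (n + n) i * a ^ n * a ^ ((i : ℤ) - n) * (Q ^ tri i * Q ^ (-(n * i : ℤ))) := by ring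
        _ = _ := by rw [← zpow_add₀ hQ0, l3, zpow_add₀ hQ0]; ring

lemma pp_tendsto {Q : ℂ} (hQ : ‖Q‖ < 1) :
    Filter.Tendsto (pp Q) Filter.atTop (nhds (qpoch Q Q)) := by
  have := (qp_mult Q hQ).hasProd.tendsto_prod_nat
  refine this.congr fun n => ?_
  unfold pp
  refine Finset.prod_congr rfl fun i _ => ?_
  ring

lemma pp_ne_zero {Q : ℂ} (hQ : ‖Q‖ < 1) (m : ℕ) : pp Q m ≠ 0 := by
  unfold pp
  refine Finset.prod_ne_zero_iff.2 fun i _ h => ?_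
  have h1 : Q ^ (i + 1) = 1 := by linear_combination -h
  have h2 := norm_pow_lt hQ (Nat.succ_ne_zero i)
  rw [h1] at h2
  simp at h2

lemma gb_eq {Q : ℂ} (hQ : ‖Q‖ < 1) {N i : ℕ} (h : i ≤ N) :
    gb Q N i = pp Q N * (pp Q i)⁻¹ * (pp Q (N - i))⁻¹ := by
  have := gb_pp Q N i (N - i) (by omega)
  have h1 := pp_ne_zero hQ i
  have h2 := pp_ne_zero hQ (N - i)
  field_simp
  linear_combination this

lemma gb_bound {Q : ℂ} (hQ : ‖Q‖ < 1) : ∃ M : ℝ, 0 ≤ M ∧ ∀ N i, ‖gb Q N i‖ ≤ M := by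
  have t1 := pp_tendsto hQ
  have t2 := t1.inv₀ (qp_ne_zero' hQ hQ)
  obtain ⟨M1, h1⟩ := (Metric.isBounded_range_of_tendsto _ t1).exists_norm_le
  obtain ⟨M2, h2⟩ := (Metric.isBounded_range_of_tendsto _ t2).exists_norm_le
  have h1' : ∀ n, ‖pp Q n‖ ≤ M1 := fun n => h1 _ ⟨n, rfl⟩
  have h2' : ∀ n, ‖(pp Q n)⁻¹‖ ≤ M2 := fun n => h2 _ ⟨n, rfl⟩
  have m1 : 0 ≤ M1 := (norm_nonneg _).trans (h1' 0)
  have m2 : 0 ≤ M2 := (norm_nonneg _).trans (h2' 0)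
  refine ⟨M1 * M2 * M2, by positivity, fun N i => ?_⟩
  by_cases h : i ≤ N
  · rw [gb_eq hQ h, norm_mul, norm_mul]
    gcongr
    · exact h1' _
    · exact h2' _
    · exact h2' _
  · rw [gb_gt Q N i (by omega), norm_zero]
    positivity

lemma gb_lim {Q : ℂ} (hQ : ‖Q‖ < 1) (j : ℤ) :
    Filter.Tendsto (fun n : ℕ => gb Q (2 * n) ((n + j : ℤ).toNat)) Filter.atTop
      (nhds (qpoch Q Q)⁻¹) := by
  have hE := qp_ne_zero' hQ hQ
  have t1 := pp_tendsto hQ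
  have t2 := t1.inv₀ hE
  have s1 : Filter.Tendsto (fun n : ℕ => 2 * n) Filter.atTop Filter.atTop :=
    Filter.tendsto_atTop_mono (fun n => by simp; omega) Filter.tendsto_id
  have s2 : Filter.Tendsto (fun n : ℕ => (n + j : ℤ).toNat) Filter.atTop Filter.atTop := by
    rw [Filter.tendsto_atTop_atTop]
    intro b
    exact ⟨b + j.natAbs, fun a ha => by omega⟩
  have s3 : Filter.Tendsto (fun n : ℕ => 2 * n - (n + j : ℤ).toNat) Filter.atTop Filter.atTop := by
    rw [Filter.tendsto_atTop_atTop]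
    intro b
    exact ⟨b + j.natAbs, fun a ha => by omega⟩
  have := ((t1.comp s1).mul (t2.comp s2)).mul (t2.comp s3)
  have e : qpoch Q Q * (qpoch Q Q)⁻¹ * (qpoch Q Q)⁻¹ = (qpoch Q Q)⁻¹ := by field_simp
  rw [e] at this
  refine this.congr' ?_
  filter_upwards [Filter.eventually_ge_atTop j.natAbs] with n hn
  rw [gb_eq hQ (by omega)]
  rfl

lemma fin_jtp_tsum {a Q : ℂ} (ha : a ≠ 0) (hQ0 : Q ≠ 0) (n : ℕ) :
    ∑' j : ℤ, (if -(n : ℤ) ≤ j then gb Q (2 * n) ((n + j : ℤ).toNat) else 0) *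
      (a ^ j * Q ^ tri j) =
    (∏ l ∈ Finset.range n, (1 + a * Q ^ l)) * (∏ l ∈ Finset.range n, (1 + Q / a * Q ^ l)) := by
  rw [fin_jtp ha hQ0, tsum_eq_sum (s := Finset.Icc (-(n : ℤ)) n)]
  · refine Finset.sum_nbij' (fun j => (n + j : ℤ).toNat) (fun i => (i : ℤ) - n) ?_ ?_ ?_ ?_ ?_
    · intro j hj; simp at hj ⊢; omega
    · intro j hj; simp at hj ⊢; omega
    · intro j hj; simp at hj ⊢; omega
    · intro j hj; simp
    · intro j hj
      simp at hj
      rw [if_pos hj.1]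
      have : (((n + j : ℤ).toNat : ℕ) : ℤ) - n = j := by omega
      rw [this]
  · intro j hj
    simp at hj
    by_cases h : -(n : ℤ) ≤ j
    · rw [gb_gt Q (2 * n) _ (by have := hj h; omega)]
      simp
    · simp [h]

theorem jtp {a Q : ℂ} (ha : a ≠ 0) (hQ0 : Q ≠ 0) (hQ : ‖Q‖ < 1) :
    th a Q = qpoch (-a) Q * qpoch (-(Q / a)) Q * qpoch Q Q := by
  obtain ⟨M, hM, hb⟩ := gb_bound hQ
  have hE := qp_ne_zero' hQ hQ
  have lim1 : Filter.Tendsto (fun n : ℕ => ∑' j : ℤ,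
      (if -(n : ℤ) ≤ j then gb Q (2 * n) ((n + j : ℤ).toNat) else 0) * (a ^ j * Q ^ tri j))
      Filter.atTop (nhds (∑' j : ℤ, (qpoch Q Q)⁻¹ * (a ^ j * Q ^ tri j))) := by
    apply tendsto_tsum_of_dominated_convergence (bound := fun j : ℤ => M * ‖a ^ j * Q ^ tri j‖)
    · exact (th_summable ha hQ0 hQ).norm.mul_left M
    · intro j
      apply Filter.Tendsto.mul_const
      refine (gb_lim hQ j).congr' ?_
      filter_upwards [Filter.eventually_ge_atTop j.natAbs] with n hn
      rw [if_pos (by omega)]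
    · filter_upwards with n j
      rw [norm_mul]
      gcongr
      split_ifs
      · exact hb _ _
      · simpa using hM
  have lim2 : Filter.Tendsto (fun n : ℕ => (∏ l ∈ Finset.range n, (1 + a * Q ^ l)) *
      (∏ l ∈ Finset.range n, (1 + Q / a * Q ^ l))) Filter.atTop
      (nhds (qpoch (-a) Q * qpoch (-(Q / a)) Q)) := by
    apply Filter.Tendsto.mul
    · simpa [qpoch] using (qp_mult (-a) hQ).hasProd.tendsto_prod_nat
    · simpa [qpoch] using (qp_mult (-(Q / a)) hQ).hasProd.tendsto_prod_nat
  simp_rw [fin_jtp_tsum ha hQ0] at lim1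
  have := tendsto_nhds_unique lim1 lim2
  rw [tsum_mul_left] at this
  rw [← this]
  unfold th
  field_simp

/-! ### Product evaluations -/

/-- Euler's product `(q;q)_∞`. -/
noncomputable def ee (q : ℂ) : ℂ := qpoch q q

lemma ee_ne {q : ℂ} (hq : ‖q‖ < 1) : ee q ≠ 0 := qp_ne_zero' hq hq

lemma ee_split2 {q : ℂ} (hq : ‖q‖ < 1) : ee q = qpoch q (q ^ 2) * ee (q ^ 2) := by
  unfold ee
  rw [qp_split q hq 2]
  simp only [Finset.prod_range_succ, Finset.prod_range_zero, pow_zero, pow_one, mul_one, one_mul]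
  ring_nf

lemma ee_mul_neg {q : ℂ} (hq : ‖q‖ < 1) : ee q * qpoch (-q) q = ee (q ^ 2) := qp_mul_neg q hq

lemma ee_neg {q : ℂ} (hq : ‖q‖ < 1) : ee (-q) * ee q * ee (q ^ 4) = ee (q ^ 2) ^ 3 := by
  have h1 := ee_split2 hq
  have h2 := ee_split2 (q := -q) (by simpa using hq)
  have h3 := ee_split2 (norm_pow_lt hq two_ne_zero)
  have h4 := qp_mul_neg q (norm_pow_lt hq two_ne_zero)
  have e : (-q) ^ 2 = q ^ 2 := by ring
  have e' : (q ^ 2) ^ 2 = q ^ 4 := by ring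
  rw [e] at h2
  rw [e'] at h3 h4
  rw [h1, h2]
  linear_combination ee (q ^ 2) ^ 2 * ee (q ^ 4) * h4 - ee (q ^ 2) ^ 2 * h3

lemma phi_prod {q : ℂ} (h0 : q ≠ 0) (hq : ‖q‖ < 1) :
    th (-q) (q ^ 2) * ee (q ^ 2) = ee q ^ 2 := by
  rw [jtp (neg_ne_zero.2 h0) (pow_ne_zero 2 h0) (norm_pow_lt hq two_ne_zero), ee_split2 hq]
  have : -(q ^ 2 / -q) = q := by field_simp
  rw [this, neg_neg]
  unfold ee
  ring

lemma psi_prod {q : ℂ} (h0 : q ≠ 0) (hq : ‖q‖ < 1) :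
    th q q * ee q = 2 * ee (q ^ 2) ^ 2 := by
  rw [jtp h0 h0 hq, div_self h0, qp_succ (-1) hq, ← ee_mul_neg hq]
  unfold ee
  rw [neg_one_mul]
  ring

lemma ff3_prod {q : ℂ} (h0 : q ≠ 0) (hq : ‖q‖ < 1) :
    th (q ^ 3) (q ^ 5) * th (q ^ 4) (q ^ 5) * (ee q * ee (q ^ 10)) = ee (q ^ 2) * ee (q ^ 5) ^ 3 := by
  have h5 := norm_pow_lt hq (m := 5) (by norm_num)
  rw [jtp (pow_ne_zero 3 h0) (pow_ne_zero 5 h0) h5, jtp (pow_ne_zero 4 h0) (pow_ne_zero 5 h0) h5]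
  have e1 : q ^ 5 / q ^ 3 = q ^ 2 := by field_simp
  have e2 : q ^ 5 / q ^ 4 = q := by field_simp
  have s := qp_split (-q) hq 5
  have m1 := ee_mul_neg hq
  have m2 := ee_mul_neg h5
  have e3 : (q ^ 5) ^ 2 = q ^ 10 := by ring
  have r1 : -q * q = -q ^ 2 := by ring
  have r2 : -q * q ^ 2 = -q ^ 3 := by ring
  have r3 : -q * q ^ 3 = -q ^ 4 := by ring
  have r4 : -q * q ^ 4 = -q ^ 5 := by ring
  simp only [Finset.prod_range_succ, Finset.prod_range_zero, pow_zero, pow_one, mul_one, one_mul,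
    r1, r2, r3, r4] at s
  rw [e1, e2, ← m1, s, ← e3, ← m2]
  unfold ee
  ring

lemma ff4_prod {q : ℂ} (h0 : q ≠ 0) (hq : ‖q‖ < 1) :
    th (-q ^ 9) (q ^ 10) * th (-q ^ 7) (q ^ 10) * (ee (q ^ 2) * ee (q ^ 5))
      = ee q * ee (q ^ 10) ^ 3 := by
  have h10 := norm_pow_lt hq (m := 10) (by norm_num)
  have h5 := norm_pow_lt hq (m := 5) (by norm_num)
  have h2 := norm_pow_lt hq (m := 2) (by norm_num)
  rw [jtp (neg_ne_zero.2 (pow_ne_zero 9 h0)) (pow_ne_zero 10 h0) h10,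
    jtp (neg_ne_zero.2 (pow_ne_zero 7 h0)) (pow_ne_zero 10 h0) h10]
  have e1 : -(q ^ 10 / -q ^ 9) = q := by field_simp
  have e2 : -(q ^ 10 / -q ^ 7) = q ^ 3 := by field_simp
  have s := qp_split q h2 5
  have m1 := ee_split2 hq
  have m2 := ee_split2 h5
  have e3 : (q ^ 5) ^ 2 = q ^ 10 := by ring
  have r0 : (q ^ 2) ^ 5 = q ^ 10 := by ring
  have r1 : q * q ^ 2 = q ^ 3 := by ring
  have r2 : q * (q ^ 2) ^ 2 = q ^ 5 := by ring
  have r3 : q * (q ^ 2) ^ 3 = q ^ 7 := by ring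
  have r4 : q * (q ^ 2) ^ 4 = q ^ 9 := by ring
  simp only [Finset.prod_range_succ, Finset.prod_range_zero, pow_zero, pow_one, mul_one, one_mul,
    r0, r1, r2, r3, r4] at s
  rw [e3] at m2
  rw [e1, e2, m1, s, m2]
  simp only [neg_neg]
  unfold ee
  ring

lemma pent_prod {q : ℂ} (h0 : q ≠ 0) (hq : ‖q‖ < 1) : th (-q) (q ^ 3) = ee q := by
  have h3 := norm_pow_lt hq (m := 3) (by norm_num)
  rw [jtp (neg_ne_zero.2 h0) (pow_ne_zero 3 h0) h3]
  have e1 : -(q ^ 3 / -q) = q ^ 2 := by field_simp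
  have s := qp_split q hq 3
  have r1 : q * q = q ^ 2 := by ring
  have r2 : q * q ^ 2 = q ^ 3 := by ring
  simp only [Finset.prod_range_succ, Finset.prod_range_zero, pow_zero, pow_one, mul_one, one_mul,
    r1, r2] at s
  rw [ee, s, e1, neg_neg]

lemma ee_split5 {q z : ℂ} (hq : ‖q‖ < 1) (hz : z ^ 5 = 1) (hn : ‖z‖ = 1) : ee (z * q) =
    qpoch (z * q) (q ^ 5) * qpoch (z ^ 2 * q ^ 2) (q ^ 5) * qpoch (z ^ 3 * q ^ 3) (q ^ 5) *
      qpoch (z ^ 4 * q ^ 4) (q ^ 5) * ee (q ^ 5) := by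
  have s := qp_split (z * q) (q := z * q) (by simpa [hn] using hq) 5
  have r0 : (z * q) ^ 5 = q ^ 5 := by rw [mul_pow, hz, one_mul]
  have r1 : z * q * (z * q) = z ^ 2 * q ^ 2 := by ring
  have r2 : z * q * (z * q) ^ 2 = z ^ 3 * q ^ 3 := by ring
  have r3 : z * q * (z * q) ^ 3 = z ^ 4 * q ^ 4 := by ring
  have r4 : z * q * (z * q) ^ 4 = q ^ 5 := by rw [← r0]; ring
  simp only [Finset.prod_range_succ, Finset.prod_range_zero, pow_zero, pow_one, mul_one, one_mul,
    r0, r1, r2, r3, r4] at s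
  exact s

lemma ee_five {q z : ℂ} (hq : ‖q‖ < 1) (hz : 1 + z + z ^ 2 + z ^ 3 + z ^ 4 = 0) (hn : ‖z‖ = 1) :
    ee q * ee (z * q) * ee (z ^ 2 * q) * ee (z ^ 3 * q) * ee (z ^ 4 * q) * ee (q ^ 25)
      = ee (q ^ 5) ^ 6 := by
  have h5 : z ^ 5 = 1 := by linear_combination (z - 1) * hz
  have q5 := norm_pow_lt hq (m := 5) (by norm_num)
  have s0 := ee_split5 (z := 1) hq (by simp) (by simp)
  have s1 := ee_split5 (z := z) hq h5 hn
  have s2 := ee_split5 (z := z ^ 2) hq (by rw [← pow_mul, pow_mul' z 2 5, h5, one_pow]) (by simp [hn])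
  have s3 := ee_split5 (z := z ^ 3) hq (by rw [← pow_mul, pow_mul' z 3 5, h5, one_pow]) (by simp [hn])
  have s4 := ee_split5 (z := z ^ 4) hq (by rw [← pow_mul, pow_mul' z 4 5, h5, one_pow]) (by simp [hn])
  have f := ee_split5 (z := 1) q5 (by simp) (by simp)
  have g1 := qp_five q z q5 hz
  have g2 := qp_five (q ^ 2) z q5 hz
  have g3 := qp_five (q ^ 3) z q5 hz
  have g4 := qp_five (q ^ 4) z q5 hz
  have t6 : z ^ 6 = z := by linear_combination z * h5
  have t8 : z ^ 8 = z ^ 3 := by linear_combination z ^ 3 * h5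
  have t9 : z ^ 9 = z ^ 4 := by linear_combination z ^ 4 * h5
  have t12 : z ^ 12 = z ^ 2 := by linear_combination (z ^ 7 + z ^ 2) * h5
  have t16 : z ^ 16 = z := by linear_combination (z ^ 11 + z ^ 6 + z) * h5
  simp only [one_pow, one_mul] at s0 f
  simp only [← pow_mul, Nat.reduceMul, t6, t8, t9, t12, t16] at s0 s1 s2 s3 s4 f g1 g2 g3 g4
  rw [s0, s1, s2, s3, s4]
  calc _ = ee (q ^ 5) ^ 5 * (qpoch (q ^ 5) (q ^ 25) * qpoch (q ^ 10) (q ^ 25) * qpoch (q ^ 15) (q ^ 25)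
        * qpoch (q ^ 20) (q ^ 25) * ee (q ^ 25)) := by
        rw [← g1, ← g2, ← g3, ← g4]; ring
    _ = _ := by rw [← f]; ring

/-! ### Lattice sums -/

lemma th_symm {a Q : ℂ} (hQ0 : Q ≠ 0) : th a Q = th (Q / a) Q := by
  unfold th
  rw [← (Equiv.neg ℤ).tsum_eq]
  refine tsum_congr fun j => ?_
  simp only [Equiv.neg_apply]
  rw [tri_neg, zpow_add₀ hQ0, div_zpow, zpow_neg]
  field_simp

lemma th_shift {a Q : ℂ} (ha : a ≠ 0) (hQ0 : Q ≠ 0) : a * th (a * Q) Q = th a Q := by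
  unfold th
  rw [← (Equiv.addRight (1 : ℤ)).tsum_eq (fun j : ℤ => a ^ j * Q ^ tri j), ← tsum_mul_left]
  refine tsum_congr fun j => ?_
  simp only [Equiv.coe_addRight]
  rw [tri_add_one, zpow_add₀ hQ0, mul_zpow, zpow_add_one₀ ha]
  ring

/-- Offsets of the five cosets. -/
def offI : Fin 5 → ℤ := ![0, 1, 0, 0, -1]
/-- Offsets of the five cosets. -/
def offJ : Fin 5 → ℤ := ![0, 0, 1, -1, 0]

lemma lat_bij : Function.Bijective (fun p : Fin 5 × (ℤ × ℤ) =>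
    ((2 * p.2.1 + p.2.2 + offI p.1, 2 * p.2.2 - p.2.1 + offJ p.1) : ℤ × ℤ)) := by
  constructor
  · rintro ⟨r, m, n⟩ ⟨r', m', n'⟩ h
    simp only [Prod.mk.injEq] at h
    obtain ⟨h1, h2⟩ := h
    fin_cases r <;> fin_cases r' <;> simp [offI, offJ] at h1 h2 ⊢ <;> omega
  · rintro ⟨x, y⟩
    have h : (x + 2 * y) % 5 = 0 ∨ (x + 2 * y) % 5 = 1 ∨ (x + 2 * y) % 5 = 2 ∨
      (x + 2 * y) % 5 = 3 ∨ (x + 2 * y) % 5 = 4 := by omega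
    rcases h with h | h | h | h | h
    · refine ⟨(0, ((2 * x - y) / 5, (x + 2 * y) / 5)), ?_⟩
      simp [offI, offJ]; omega
    · refine ⟨(1, ((2 * (x - 1) - y) / 5, (x - 1 + 2 * y) / 5)), ?_⟩
      simp [offI, offJ]; omega
    · refine ⟨(2, ((2 * x - (y - 1)) / 5, (x + 2 * (y - 1)) / 5)), ?_⟩
      simp [offI, offJ]; omega
    · refine ⟨(3, ((2 * x - (y + 1)) / 5, (x + 2 * (y + 1)) / 5)), ?_⟩
      simp [offI, offJ]; omega
    · refine ⟨(4, ((2 * (x + 1) - y) / 5, (x + 1 + 2 * y) / 5)), ?_⟩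
      simp [offI, offJ]; omega

lemma lattice5 {w : ℤ × ℤ → ℂ} (hw : Summable w) :
    ∑' p, w p = (∑' p : ℤ × ℤ, w (2 * p.1 + p.2 + 0, 2 * p.2 - p.1 + 0))
      + (∑' p : ℤ × ℤ, w (2 * p.1 + p.2 + 1, 2 * p.2 - p.1 + 0))
      + (∑' p : ℤ × ℤ, w (2 * p.1 + p.2 + 0, 2 * p.2 - p.1 + 1))
      + (∑' p : ℤ × ℤ, w (2 * p.1 + p.2 + 0, 2 * p.2 - p.1 + -1))
      + (∑' p : ℤ × ℤ, w (2 * p.1 + p.2 + -1, 2 * p.2 - p.1 + 0)) := by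
  have hs := (Equiv.summable_iff (Equiv.ofBijective _ lat_bij) (f := w)).2 hw
  rw [← (Equiv.ofBijective _ lat_bij).tsum_eq w]
  have := hs.tsum_prod' (fun b => hs.prod_factor b)
  simp only [Function.comp_apply] at this
  rw [this, tsum_fintype, Fin.sum_univ_five]
  simp [offI, offJ]

lemma tsum_class {g : ℤ → ℂ} {i j : ℤ} {k a b Q : ℂ} (ha : a ≠ 0) (hb : b ≠ 0) (hQ0 : Q ≠ 0)
    (hQ : ‖Q‖ < 1) (h : ∀ m n : ℤ, g (2 * m + n + i) * g (2 * n - m + j) =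
      k * ((a ^ m * Q ^ tri m) * (b ^ n * Q ^ tri n))) :
    ∑' p : ℤ × ℤ, g (2 * p.1 + p.2 + i) * g (2 * p.2 - p.1 + j) = k * (th a Q * th b Q) := by
  unfold th
  rw [tsum_mul_tsum_of_summable_norm (th_summable ha hQ0 hQ).norm (th_summable hb hQ0 hQ).norm,
    ← tsum_mul_left]
  exact tsum_congr fun p => h p.1 p.2

lemma term_eq {q : ℂ} (h0 : q ≠ 0) (s : ℂ) (c d : ℕ) (j : ℤ) :
    (s * q ^ c) ^ j * (q ^ d) ^ tri j = s ^ j * q ^ (c * j + d * tri j) := by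
  rw [mul_zpow, zpow_add₀ h0, zpow_mul, zpow_mul, zpow_natCast, zpow_natCast]
  ring

lemma term_eq1 {q : ℂ} (h0 : q ≠ 0) (c d : ℕ) (j : ℤ) :
    (q ^ c) ^ j * (q ^ d) ^ tri j = q ^ (c * j + d * tri j) := by
  simpa using term_eq h0 1 c d j

lemma sgn_eq {A B : ℤ} (h : Even (A - B)) : (-1 : ℂ) ^ A = (-1) ^ B := by
  have : A = (A - B) + B := by ring
  rw [this, zpow_add₀ (by norm_num), h.neg_one_zpow, one_mul]

lemma psi_term {q : ℂ} (h0 : q ≠ 0) (x y m n i j : ℤ) (k c d : ℕ) (hx : x = 2 * m + n + i)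
    (hy : y = 2 * n - m + j)
    (he : ∀ m n : ℤ, (2 * m + n + i) * (2 * m + n + i + 1) + (2 * n - m + j) * (2 * n - m + j + 1) =
      2 * k + 2 * c * m + 5 * (m * (m - 1)) + 2 * d * n + 5 * (n * (n - 1))) :
    ((q ^ 1) ^ x * (q ^ 1) ^ tri x) * ((q ^ 1) ^ y * (q ^ 1) ^ tri y) =
      q ^ k * (((q ^ c) ^ m * (q ^ 5) ^ tri m) * ((q ^ d) ^ n * (q ^ 5) ^ tri n)) := by
  rw [term_eq1 h0, term_eq1 h0, term_eq1 h0, term_eq1 h0, ← zpow_add₀ h0, ← zpow_add₀ h0,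
    ← zpow_natCast q k, ← zpow_add₀ h0]
  congr 1
  have t1 := two_tri x
  have t2 := two_tri y
  have t3 := two_tri m
  have t4 := two_tri n
  have := he m n
  rw [← hx, ← hy] at this
  have e : 2 * (((1 : ℕ) : ℤ) * x + (1 : ℕ) * tri x + ((1 : ℕ) * y + (1 : ℕ) * tri y)) =
    2 * ((k : ℤ) + (c * m + (5 : ℕ) * tri m + (d * n + (5 : ℕ) * tri n))) := by
    push_cast
    linear_combination t1 + t2 - 5 * t3 - 5 * t4 + this
  omega

lemma T3_th {q : ℂ} (h0 : q ≠ 0) (hq : ‖q‖ < 1) :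
    th q q ^ 2 = q * th (q ^ 5) (q ^ 5) ^ 2 + 4 * (th (q ^ 3) (q ^ 5) * th (q ^ 4) (q ^ 5)) := by
  have h5 := norm_pow_lt hq (m := 5) (by norm_num)
  have z5 := pow_ne_zero 5 h0
  have hs := (th_summable (pow_ne_zero 1 h0) (pow_ne_zero 1 h0) (norm_pow_lt hq one_ne_zero)).norm
  have e1 : th q q ^ 2 = ∑' p : ℤ × ℤ, ((q ^ 1) ^ p.1 * (q ^ 1) ^ tri p.1) *
      ((q ^ 1) ^ p.2 * (q ^ 1) ^ tri p.2) := by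
    rw [← tsum_mul_tsum_of_summable_norm hs hs]
    simp only [pow_one, th]
    ring
  have hw := summable_mul_of_summable_norm hs hs
  rw [e1, lattice5 hw]
  have c0 := tsum_class (g := fun j : ℤ => (q ^ 1) ^ j * (q ^ 1) ^ tri j) (i := 0) (j := 0)
    (pow_ne_zero 3 h0) (pow_ne_zero 4 h0) z5 h5
    (fun m n => psi_term h0 _ _ m n 0 0 0 3 4 rfl rfl (fun m n => by push_cast; ring))
  have c1 := tsum_class (g := fun j : ℤ => (q ^ 1) ^ j * (q ^ 1) ^ tri j) (i := 1) (j := 0)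
    (pow_ne_zero 5 h0) (pow_ne_zero 5 h0) z5 h5
    (fun m n => psi_term h0 _ _ m n 1 0 1 5 5 rfl rfl (fun m n => by push_cast; ring))
  have c2 := tsum_class (g := fun j : ℤ => (q ^ 1) ^ j * (q ^ 1) ^ tri j) (i := 0) (j := 1)
    (pow_ne_zero 2 h0) (pow_ne_zero 6 h0) z5 h5
    (fun m n => psi_term h0 _ _ m n 0 1 1 2 6 rfl rfl (fun m n => by push_cast; ring))
  have c3 := tsum_class (g := fun j : ℤ => (q ^ 1) ^ j * (q ^ 1) ^ tri j) (i := 0) (j := -1)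
    (pow_ne_zero 4 h0) (pow_ne_zero 2 h0) z5 h5
    (fun m n => psi_term h0 _ _ m n 0 (-1) 0 4 2 rfl rfl (fun m n => by push_cast; ring))
  have c4 := tsum_class (g := fun j : ℤ => (q ^ 1) ^ j * (q ^ 1) ^ tri j) (i := -1) (j := 0)
    (pow_ne_zero 1 h0) (pow_ne_zero 3 h0) z5 h5
    (fun m n => psi_term h0 _ _ m n (-1) 0 0 1 3 rfl rfl (fun m n => by push_cast; ring))
  have s1 : th (q ^ 2) (q ^ 5) = th (q ^ 3) (q ^ 5) := by
    rw [th_symm z5]; congr 1; field_simp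
  have s2 : th (q ^ 1) (q ^ 5) = th (q ^ 4) (q ^ 5) := by
    rw [th_symm z5]; congr 1; field_simp
  have s3 : q * th (q ^ 6) (q ^ 5) = th (q ^ 4) (q ^ 5) := by
    rw [← s2, pow_one, ← th_shift h0 z5]; congr 2; ring
  simp only at c0 c1 c2 c3 c4 ⊢
  rw [c0, c1, c2, c3, c4, s1, s2]
  linear_combination th (q ^ 3) (q ^ 5) * s3

lemma phi_term {q : ℂ} (h0 : q ≠ 0) (x y m n i j : ℤ) (s : ℂ) (k c d : ℕ) (hx : x = 2 * m + n + i)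
    (hy : y = 2 * n - m + j) (hs : s = (-1) ^ (i + j))
    (he : ∀ m n : ℤ, (2 * m + n + i) ^ 2 + (2 * n - m + j) ^ 2 =
      k + c * m + 5 * (m * (m - 1)) + d * n + 5 * (n * (n - 1))) :
    ((-1 * q ^ 1) ^ x * (q ^ 2) ^ tri x) * ((-1 * q ^ 1) ^ y * (q ^ 2) ^ tri y) =
      s * q ^ k * (((-1 * q ^ c) ^ m * (q ^ 10) ^ tri m) * ((-1 * q ^ d) ^ n * (q ^ 10) ^ tri n)) := by
  rw [term_eq h0, term_eq h0, term_eq h0, term_eq h0]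
  have t1 := two_tri x
  have t2 := two_tri y
  have t3 := two_tri m
  have t4 := two_tri n
  have h := he m n
  rw [← hx, ← hy] at h
  have e : (((1 : ℕ) : ℤ) * x + (2 : ℕ) * tri x + ((1 : ℕ) * y + (2 : ℕ) * tri y)) =
    ((k : ℤ) + (c * m + (10 : ℕ) * tri m + (d * n + (10 : ℕ) * tri n))) := by
    push_cast
    linear_combination t1 + t2 - 5 * t3 - 5 * t4 + h
  have n1 : (-1 : ℂ) ≠ 0 := by norm_num
  have sg : (-1 : ℂ) ^ (x + y) = (-1) ^ ((i + j) + (m + n)) := by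
    apply sgn_eq
    exact ⟨n, by rw [hx, hy]; ring⟩
  rw [hs]
  calc _ = (-1 : ℂ) ^ (x + y) * q ^ (((1 : ℕ) : ℤ) * x + (2 : ℕ) * tri x + ((1 : ℕ) * y + (2 : ℕ) * tri y)) := by
        rw [zpow_add₀ n1, zpow_add₀ h0 (((1 : ℕ) : ℤ) * x + (2 : ℕ) * tri x)]; ring
    _ = _ := by
        rw [e, sg, zpow_add₀ n1, zpow_add₀ n1 m, zpow_add₀ h0 (k : ℤ), zpow_natCast,
          zpow_add₀ h0 (c * m + (10 : ℕ) * tri m)]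
        ring

lemma T4_th {q : ℂ} (h0 : q ≠ 0) (hq : ‖q‖ < 1) :
    th (-q) (q ^ 2) ^ 2 = th (-q ^ 5) (q ^ 10) ^ 2
      - 4 * q * (th (-q ^ 9) (q ^ 10) * th (-q ^ 7) (q ^ 10)) := by
  have h5 := norm_pow_lt hq (m := 10) (by norm_num)
  have z5 := pow_ne_zero 10 h0
  have nz : ∀ c : ℕ, -1 * q ^ c ≠ 0 := fun c => mul_ne_zero (by norm_num) (pow_ne_zero c h0)
  have hs := (th_summable (nz 1) (pow_ne_zero 2 h0) (norm_pow_lt hq two_ne_zero)).norm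
  have e1 : th (-q) (q ^ 2) ^ 2 = ∑' p : ℤ × ℤ, ((-1 * q ^ 1) ^ p.1 * (q ^ 2) ^ tri p.1) *
      ((-1 * q ^ 1) ^ p.2 * (q ^ 2) ^ tri p.2) := by
    rw [← tsum_mul_tsum_of_summable_norm hs hs]
    simp only [pow_one, th, neg_one_mul]
    ring
  have hw := summable_mul_of_summable_norm hs hs
  rw [e1, lattice5 hw]
  have c0 := tsum_class (g := fun j : ℤ => (-1 * q ^ 1) ^ j * (q ^ 2) ^ tri j) (i := 0) (j := 0)
    (nz 5) (nz 5) z5 h5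
    (fun m n => phi_term h0 _ _ m n 0 0 1 0 5 5 rfl rfl (by simp) (fun m n => by push_cast; ring))
  have c1 := tsum_class (g := fun j : ℤ => (-1 * q ^ 1) ^ j * (q ^ 2) ^ tri j) (i := 1) (j := 0)
    (nz 9) (nz 7) z5 h5
    (fun m n => phi_term h0 _ _ m n 1 0 (-1) 1 9 7 rfl rfl (by simp) (fun m n => by push_cast; ring))
  have c2 := tsum_class (g := fun j : ℤ => (-1 * q ^ 1) ^ j * (q ^ 2) ^ tri j) (i := 0) (j := 1)
    (nz 3) (nz 9) z5 h5
    (fun m n => phi_term h0 _ _ m n 0 1 (-1) 1 3 9 rfl rfl (by simp) (fun m n => by push_cast; ring))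
  have c3 := tsum_class (g := fun j : ℤ => (-1 * q ^ 1) ^ j * (q ^ 2) ^ tri j) (i := 0) (j := -1)
    (nz 7) (nz 1) z5 h5
    (fun m n => phi_term h0 _ _ m n 0 (-1) (-1) 1 7 1 rfl rfl (by simp)
      (fun m n => by push_cast; ring))
  have c4 := tsum_class (g := fun j : ℤ => (-1 * q ^ 1) ^ j * (q ^ 2) ^ tri j) (i := -1) (j := 0)
    (nz 1) (nz 3) z5 h5
    (fun m n => phi_term h0 _ _ m n (-1) 0 (-1) 1 1 3 rfl rfl (by simp)
      (fun m n => by push_cast; ring))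
  have s1 : th (-q ^ 3) (q ^ 10) = th (-q ^ 7) (q ^ 10) := by
    rw [th_symm z5]; congr 1; field_simp
  have s2 : th (-q ^ 1) (q ^ 10) = th (-q ^ 9) (q ^ 10) := by
    rw [th_symm z5]; congr 1; field_simp
  simp only at c0 c1 c2 c3 c4 ⊢
  rw [c0, c1, c2, c3, c4]
  simp only [neg_one_mul]
  rw [s1, s2]
  ring

/-! ### Eta quotient identities -/

lemma R3 {q : ℂ} (h0 : q ≠ 0) (hq : ‖q‖ < 1) :
    ee (q ^ 2) ^ 4 / ee q ^ 2 = q * ee (q ^ 10) ^ 4 / ee (q ^ 5) ^ 2 +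
      ee (q ^ 2) * ee (q ^ 5) ^ 3 / (ee q * ee (q ^ 10)) := by
  have h5 := norm_pow_lt hq (m := 5) (by norm_num)
  have t := T3_th h0 hq
  have e1 := ee_ne hq
  have e5 := ee_ne h5
  have e10 := ee_ne (norm_pow_lt hq (m := 10) (by norm_num))
  have p1 : th q q = 2 * ee (q ^ 2) ^ 2 / ee q := by
    rw [eq_div_iff e1, psi_prod h0 hq]
  have p2 : th (q ^ 5) (q ^ 5) = 2 * ee (q ^ 10) ^ 2 / ee (q ^ 5) := by
    rw [eq_div_iff e5, psi_prod (pow_ne_zero 5 h0) h5, ← pow_mul]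
  have p3 : th (q ^ 3) (q ^ 5) * th (q ^ 4) (q ^ 5) =
      ee (q ^ 2) * ee (q ^ 5) ^ 3 / (ee q * ee (q ^ 10)) := by
    rw [eq_div_iff (mul_ne_zero e1 e10), ff3_prod h0 hq]
  rw [p1, p2, p3] at t
  linear_combination (1 / 4) * t

lemma R4 {q : ℂ} (h0 : q ≠ 0) (hq : ‖q‖ < 1) :
    ee q ^ 4 / ee (q ^ 2) ^ 2 = ee (q ^ 5) ^ 4 / ee (q ^ 10) ^ 2 -
      4 * q * (ee q * ee (q ^ 10) ^ 3 / (ee (q ^ 2) * ee (q ^ 5))) := by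
  have h5 := norm_pow_lt hq (m := 5) (by norm_num)
  have t := T4_th h0 hq
  have e2 := ee_ne (norm_pow_lt hq (m := 2) (by norm_num))
  have e5 := ee_ne h5
  have e10 := ee_ne (norm_pow_lt hq (m := 10) (by norm_num))
  have p1 : th (-q) (q ^ 2) = ee q ^ 2 / ee (q ^ 2) := by
    rw [eq_div_iff e2, phi_prod h0 hq]
  have p2 : th (-q ^ 5) (q ^ 10) = ee (q ^ 5) ^ 2 / ee (q ^ 10) := by
    have := phi_prod (pow_ne_zero 5 h0) h5
    rw [← pow_mul] at this
    rw [eq_div_iff e10, this]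
  have p3 : th (-q ^ 9) (q ^ 10) * th (-q ^ 7) (q ^ 10) =
      ee q * ee (q ^ 10) ^ 3 / (ee (q ^ 2) * ee (q ^ 5)) := by
    rw [eq_div_iff (mul_ne_zero e2 e5), ff4_prod h0 hq]
  rw [p1, p2, p3] at t
  linear_combination t

lemma alg_uv {q e1 e2 e5 e10 : ℂ} (h0 : q ≠ 0) (h1 : e1 ≠ 0) (h2 : e2 ≠ 0) (h5 : e5 ≠ 0)
    (h10 : e10 ≠ 0)
    (r3 : e2 ^ 4 / e1 ^ 2 = q * e10 ^ 4 / e5 ^ 2 + e2 * e5 ^ 3 / (e1 * e10))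
    (r4 : e1 ^ 4 / e2 ^ 2 = e5 ^ 4 / e10 ^ 2 - 4 * q * (e1 * e10 ^ 3 / (e2 * e5))) :
    e2 ^ 4 * e5 ^ 2 / (q * e1 ^ 2 * e10 ^ 4) = e2 * e5 ^ 5 / (q * e1 * e10 ^ 5) + 1 ∧
    e1 ^ 3 * e5 / (q * e2 * e10 ^ 3) = e2 * e5 ^ 5 / (q * e1 * e10 ^ 5) - 4 := by
  constructor
  · field_simp at r3 ⊢
    linear_combination r3
  · field_simp at r4 ⊢
    linear_combination r4

/-- `C(q) = q (q⁵;q⁵)⁵ / (q;q)`. -/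
noncomputable def CC (q : ℂ) : ℂ := q * ee (q ^ 5) ^ 5 / ee q
/-- `D(q) = (q;q)⁵ / (q⁵;q⁵)`. -/
noncomputable def DD (q : ℂ) : ℂ := ee q ^ 5 / ee (q ^ 5)

lemma algA {q e1 e2 e5 e10 : ℂ} (h0 : q ≠ 0) (h1 : e1 ≠ 0) (h2 : e2 ≠ 0) (h5 : e5 ≠ 0)
    (h10 : e10 ≠ 0)
    (r3 : e2 ^ 4 / e1 ^ 2 = q * e10 ^ 4 / e5 ^ 2 + e2 * e5 ^ 3 / (e1 * e10))
    (r4 : e1 ^ 4 / e2 ^ 2 = e5 ^ 4 / e10 ^ 2 - 4 * q * (e1 * e10 ^ 3 / (e2 * e5))) :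
    5 * ((e5 ^ 2 / e10) ^ 5 / (e1 ^ 2 / e2)) = 15 * (q * e5 ^ 5 / e1) + 20 * (q ^ 2 * e10 ^ 5 / e2)
      + e1 ^ 5 / e5 + 4 * (e2 ^ 5 / e10) := by
  obtain ⟨ht, hv⟩ := alg_uv h0 h1 h2 h5 h10 r3 r4
  set u := e2 * e5 ^ 5 / (q * e1 * e10 ^ 5) with hu
  set c := q ^ 2 * e10 ^ 5 / e2 with hc
  have u0 : u ≠ 0 := by
    rw [hu]; positivity
  have a1 : (e5 ^ 2 / e10) ^ 5 / (e1 ^ 2 / e2) = c * u ^ 2 := by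
    rw [hu, hc]; field_simp
  have a2 : q * e5 ^ 5 / e1 = c * u := by
    rw [hu, hc]; field_simp
  have a3 : e1 ^ 5 / e5 = c * (e2 ^ 4 * e5 ^ 2 / (q * e1 ^ 2 * e10 ^ 4)) *
      (e1 ^ 3 * e5 / (q * e2 * e10 ^ 3)) ^ 2 / u := by
    rw [hu, hc]; field_simp
  have a4 : e2 ^ 5 / e10 = c * (e2 ^ 4 * e5 ^ 2 / (q * e1 ^ 2 * e10 ^ 4)) ^ 2 *
      (e1 ^ 3 * e5 / (q * e2 * e10 ^ 3)) / u := by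
    rw [hu, hc]; field_simp
  rw [a1, a2, a3, a4, ht, hv]
  field_simp
  ring

lemma identA {q : ℂ} (h0 : q ≠ 0) (hq : ‖q‖ < 1) :
    5 * (phiNeg (q ^ 5) ^ 5 / phiNeg q) = 15 * CC q + 20 * CC (q ^ 2) + DD q + 4 * DD (q ^ 2) := by
  have h := algA h0 (ee_ne hq) (ee_ne (norm_pow_lt hq (m := 2) (by norm_num)))
    (ee_ne (norm_pow_lt hq (m := 5) (by norm_num)))
    (ee_ne (norm_pow_lt hq (m := 10) (by norm_num))) (R3 h0 hq) (R4 h0 hq)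
  unfold CC DD phiNeg
  simp only [← pow_mul, Nat.reduceMul]
  exact h

lemma algB {q e1 e2 e4 e5 e10 e20 f1 f5 : ℂ} (h0 : q ≠ 0) (h1 : e1 ≠ 0) (h2 : e2 ≠ 0)
    (h4 : e4 ≠ 0) (h5 : e5 ≠ 0) (h10 : e10 ≠ 0) (h20 : e20 ≠ 0)
    (hf1 : f1 = e2 ^ 3 / (e1 * e4)) (hf5 : f5 = e10 ^ 3 / (e5 * e20))
    (r : e2 ^ 4 / e1 ^ 2 = q * e10 ^ 4 / e5 ^ 2 + e2 * e5 ^ 3 / (e1 * e10))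
    (r' : e2 ^ 4 / f1 ^ 2 = -q * e10 ^ 4 / f5 ^ 2 + e2 * f5 ^ 3 / (f1 * e10))
    (r3 : e4 ^ 4 / e2 ^ 2 = q ^ 2 * e20 ^ 4 / e10 ^ 2 + e4 * e10 ^ 3 / (e2 * e20))
    (r4 : e2 ^ 4 / e4 ^ 2 = e10 ^ 4 / e20 ^ 2 - 4 * q ^ 2 * (e2 * e20 ^ 3 / (e4 * e10))) :
    q * e5 ^ 5 / e1 + (-q) * f5 ^ 5 / f1 = 2 * (q ^ 2 * e10 ^ 5 / e2) + 4 * (q ^ 4 * e20 ^ 5 / e4) := by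
  obtain ⟨ht, hv⟩ := alg_uv (pow_ne_zero 2 h0) h2 h4 h10 h20 r3 r4
  have z1 : f1 ≠ 0 := by rw [hf1]; positivity
  have z5 : f5 ≠ 0 := by rw [hf5]; positivity
  set u := e4 * e10 ^ 5 / (q ^ 2 * e2 * e20 ^ 5) with hu
  have u0 : u ≠ 0 := by
    rw [hu]; positivity
  set α := e2 ^ 4 / e1 ^ 2 with hα
  set β := q * e10 ^ 4 / e5 ^ 2 with hβ
  set α' := e2 ^ 4 / f1 ^ 2 with hα'
  set β' := q * e10 ^ 4 / f5 ^ 2 with hβ'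
  have b0 : β ≠ 0 := by rw [hβ]; positivity
  have b0' : β' ≠ 0 := by rw [hβ']; positivity
  have k1 : q * e5 ^ 5 / e1 = q ^ 2 * e10 ^ 5 / e2 * ((α - β) / β) := by
    have : α - β = e2 * e5 ^ 3 / (e1 * e10) := by linear_combination r
    rw [this, hβ]; field_simp
  have rr : α' + β' = e2 * f5 ^ 3 / (f1 * e10) := by
    rw [hβ']; linear_combination r'
  have k2 : (-q) * f5 ^ 5 / f1 = - (q ^ 2 * e10 ^ 5 / e2 * ((α' + β') / β')) := by
    rw [rr, hβ']; field_simp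
  have m : (α - β) * (α' + β') = u * (β * β') := by
    have : α - β = e2 * e5 ^ 3 / (e1 * e10) := by linear_combination r
    rw [this, rr, hu, hβ, hβ', hf1, hf5]; field_simp
  have n : α * α' = (e4 ^ 4 * e10 ^ 2 / (q ^ 2 * e2 ^ 2 * e20 ^ 4)) *
      (e2 ^ 3 * e10 / (q ^ 2 * e4 * e20 ^ 3)) / u * (β * β') := by
    rw [hu, hα, hα', hβ, hβ', hf1, hf5]; field_simp
  rw [ht, hv] at n
  have c4 : q ^ 4 * e20 ^ 5 / e4 = q ^ 2 * e10 ^ 5 / e2 / u := by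
    rw [hu]; field_simp
  rw [k1, k2, c4]
  have n' : u * (α * α') = (u + 1) * (u - 4) * (β * β') := by
    rw [n]; field_simp
  have key : (α - β) / β - (α' + β') / β' = 2 + 4 / u := by
    field_simp
    linear_combination u * m - n'
  linear_combination (q ^ 2 * e10 ^ 5 / e2) * key

lemma identB {q : ℂ} (h0 : q ≠ 0) (hq : ‖q‖ < 1) :
    CC q + CC (-q) = 2 * CC (q ^ 2) + 4 * CC (q ^ 4) := by
  have g : ∀ m : ℕ, m ≠ 0 → ee (q ^ m) ≠ 0 := fun m hm => ee_ne (norm_pow_lt hq hm)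
  have n1 := ee_neg hq
  have n5 := ee_neg (norm_pow_lt hq (m := 5) (by norm_num))
  have r' := R3 (q := -q) (neg_ne_zero.2 h0) (by simpa using hq)
  have h2 := norm_pow_lt hq (m := 2) (by norm_num)
  have r3 := R3 (pow_ne_zero 2 h0) h2
  have r4 := R4 (pow_ne_zero 2 h0) h2
  have o2 : (-q) ^ 2 = q ^ 2 := by ring
  have o5 : (-q) ^ 5 = -q ^ 5 := by ring
  have o10 : (-q) ^ 10 = q ^ 10 := by ring
  rw [o2, o5, o10] at r'
  simp only [← pow_mul, Nat.reduceMul] at n5 r3 r4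
  have e1 := ee_ne hq
  have f1 : ee (-q) = ee (q ^ 2) ^ 3 / (ee q * ee (q ^ 4)) := by
    rw [eq_div_iff (mul_ne_zero e1 (g 4 (by norm_num)))]
    linear_combination n1
  have f5 : ee (-q ^ 5) = ee (q ^ 10) ^ 3 / (ee (q ^ 5) * ee (q ^ 20)) := by
    rw [eq_div_iff (mul_ne_zero (g 5 (by norm_num)) (g 20 (by norm_num)))]
    linear_combination n5
  have := algB h0 e1 (g 2 (by norm_num)) (g 4 (by norm_num)) (g 5 (by norm_num))
    (g 10 (by norm_num)) (g 20 (by norm_num)) f1 f5 (R3 h0 hq) r' r3 r4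
  unfold CC
  rw [o5]
  simp only [← pow_mul, Nat.reduceMul]
  exact this

/-! ### Five-dissection of the Euler product -/

/-- Terms of the pentagonal series. -/
noncomputable def ps (q : ℂ) (j : ℤ) : ℂ := (-1) ^ j * q ^ (j + 3 * tri j)

/-- Residue parts of the pentagonal series. -/
noncomputable def QQ (r : ℤ) (q : ℂ) : ℂ := ∑' k : ℤ, ps q (5 * k + r)

lemma ps_th {q : ℂ} (h0 : q ≠ 0) (j : ℤ) : (-q) ^ j * (q ^ 3) ^ tri j = ps q j := by
  have := term_eq h0 (-1) 1 3 j
  rw [pow_one, neg_one_mul] at this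
  rw [this, ps]
  push_cast
  rw [one_mul]

lemma ps_summable {q : ℂ} (h0 : q ≠ 0) (hq : ‖q‖ < 1) : Summable (ps q) := by
  have := th_summable (neg_ne_zero.2 h0) (pow_ne_zero 3 h0) (norm_pow_lt hq three_ne_zero)
  exact this.congr (fun j => by rw [ps_th h0])

lemma ee_ps {q : ℂ} (h0 : q ≠ 0) (hq : ‖q‖ < 1) : ee q = ∑' j, ps q j := by
  rw [← pent_prod h0 hq, th]
  exact tsum_congr fun j => ps_th h0 j

/-- Residues. -/
def resR : Fin 5 → ℤ := ![0, 1, 2, 3, 4]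
/-- Carries. -/
def resK : Fin 5 → ℤ := ![1, 0, 0, -1, -1]

lemma res_bij : Function.Bijective (fun p : Fin 5 × ℤ => (5 * p.2 + resR p.1 : ℤ)) := by
  constructor
  · rintro ⟨r, m⟩ ⟨r', m'⟩ h
    simp only at h
    fin_cases r <;> fin_cases r' <;> simp [resR] at h ⊢ <;> omega
  · intro x
    have h : x % 5 = 0 ∨ x % 5 = 1 ∨ x % 5 = 2 ∨ x % 5 = 3 ∨ x % 5 = 4 := by omega
    rcases h with h | h | h | h | h
    · exact ⟨(0, x / 5), by simp [resR]; omega⟩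
    · exact ⟨(1, x / 5), by simp [resR]; omega⟩
    · exact ⟨(2, x / 5), by simp [resR]; omega⟩
    · exact ⟨(3, x / 5), by simp [resR]; omega⟩
    · exact ⟨(4, x / 5), by simp [resR]; omega⟩

lemma ee_QQ {q : ℂ} (h0 : q ≠ 0) (hq : ‖q‖ < 1) :
    ee q = QQ 0 q + QQ 1 q + QQ 2 q + QQ 3 q + QQ 4 q := by
  have hw := ps_summable h0 hq
  have hs := (Equiv.summable_iff (Equiv.ofBijective _ res_bij) (f := ps q)).2 hw
  rw [ee_ps h0 hq, ← (Equiv.ofBijective _ res_bij).tsum_eq (ps q)]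
  have := hs.tsum_prod' (fun b => hs.prod_factor b)
  simp only [Function.comp_apply] at this
  rw [this, tsum_fintype, Fin.sum_univ_five]
  simp [resR, QQ]

lemma QQ1 {q : ℂ} (h0 : q ≠ 0) (hq : ‖q‖ < 1) : QQ 1 q = -q * ee (q ^ 25) := by
  have h25 := norm_pow_lt hq (m := 25) (by norm_num)
  rw [← pent_prod (pow_ne_zero 25 h0) h25, th_symm (pow_ne_zero 3 (pow_ne_zero 25 h0))]
  have e : (q ^ 25) ^ 3 / -q ^ 25 = -1 * q ^ 50 := by field_simp
  rw [e, ← pow_mul, th, ← tsum_mul_left, QQ]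
  refine tsum_congr fun k => ?_
  rw [term_eq h0, ps]
  have t1 := two_tri (5 * k + 1)
  have t2 := two_tri k
  have e1 : 5 * k + 1 + 3 * tri (5 * k + 1) =
      1 + (((50 : ℕ) : ℤ) * k + ((25 * 3 : ℕ) : ℤ) * tri k) := by
    push_cast
    have : 2 * (5 * k + 1 + 3 * tri (5 * k + 1)) = 2 * (1 + (50 * k + 75 * tri k)) := by
      linear_combination 3 * t1 - 75 * t2
    omega
  have e2 : (-1 : ℂ) ^ (5 * k + 1) = (-1) ^ (k + 1) := sgn_eq ⟨2 * k, by ring⟩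
  rw [e1, e2, zpow_add₀ h0, zpow_one, zpow_add_one₀ (by norm_num)]
  ring

lemma ps_mul {q : ℂ} (h0 : q ≠ 0) (a b : ℤ) :
    ps q a * ps q b = (-1) ^ (a + b) * q ^ ((a + 3 * tri a) + (b + 3 * tri b)) := by
  simp only [ps]
  rw [zpow_add₀ (by norm_num : (-1 : ℂ) ≠ 0), zpow_add₀ h0 (a + 3 * tri a)]
  ring

lemma ps_invol {q : ℂ} (h0 : q ≠ 0) (m k : ℤ) :
    ps q (1 - 4 * k - m) * ps q (2 * (1 - 4 * k - m) - 1 + 5 * k) =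
      -(ps q m * ps q (2 * m - 1 + 5 * k)) := by
  have n1 : (-1 : ℂ) ≠ 0 := by norm_num
  have t1 := two_tri (1 - 4 * k - m)
  have t2 := two_tri (2 * (1 - 4 * k - m) - 1 + 5 * k)
  have t3 := two_tri m
  have t4 := two_tri (2 * m - 1 + 5 * k)
  have e : 2 * ((1 - 4 * k - m) + 3 * tri (1 - 4 * k - m) + ((2 * (1 - 4 * k - m) - 1 + 5 * k) +
      3 * tri (2 * (1 - 4 * k - m) - 1 + 5 * k))) =
      2 * (m + 3 * tri m + ((2 * m - 1 + 5 * k) + 3 * tri (2 * m - 1 + 5 * k))) := by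
    linear_combination 3 * t1 + 3 * t2 - 3 * t3 - 3 * t4
  have e' := mul_left_cancel₀ (by norm_num : (2 : ℤ) ≠ 0) e
  have s : (-1 : ℂ) ^ ((1 - 4 * k - m) + (2 * (1 - 4 * k - m) - 1 + 5 * k)) =
      (-1) ^ (m + (2 * m - 1 + 5 * k) + 1) := sgn_eq ⟨1 - 6 * k - 3 * m, by ring⟩
  rw [ps_mul h0, ps_mul h0, e', s, zpow_add_one₀ n1]
  ring

/-- The pair weight. -/
noncomputable def WW (q : ℂ) (p : ℤ × ℤ) : ℂ := ps q p.1 * ps q (2 * p.1 - 1 + 5 * p.2)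

lemma WW_zero {q : ℂ} (h0 : q ≠ 0) : ∑' p, WW q p = 0 := by
  have inv : Function.Involutive (fun p : ℤ × ℤ => ((1 - 4 * p.2 - p.1, p.2) : ℤ × ℤ)) := by
    rintro ⟨m, k⟩
    simp
  have h := (inv.toPerm _).tsum_eq (WW q)
  have h2 : ∀ p : ℤ × ℤ, WW q (inv.toPerm _ p) = - WW q p := fun p => ps_invol h0 p.1 p.2
  simp only [h2, tsum_neg] at h
  linear_combination (-1 / 2) * h

lemma WW_summable {q : ℂ} (h0 : q ≠ 0) (hq : ‖q‖ < 1) : Summable (WW q) := by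
  have hs := (ps_summable h0 hq).norm
  have hp := summable_mul_of_summable_norm hs hs
  have inj : Function.Injective (fun p : ℤ × ℤ => ((p.1, 2 * p.1 - 1 + 5 * p.2) : ℤ × ℤ)) := by
    rintro ⟨m, k⟩ ⟨m', k'⟩ h
    simp only [Prod.mk.injEq] at h ⊢
    omega
  have h3 := hp.comp_injective inj
  refine h3.congr fun p => ?_
  simp only [Function.comp_apply, WW]

lemma pair_bij : Function.Bijective (fun p : Fin 5 × (ℤ × ℤ) =>
    ((5 * p.2.1 + resR p.1, p.2.2 - 2 * p.2.1 + resK p.1) : ℤ × ℤ)) := by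
  constructor
  · rintro ⟨r, m, n⟩ ⟨r', m', n'⟩ h
    simp only [Prod.mk.injEq] at h
    obtain ⟨h1, h2⟩ := h
    fin_cases r <;> fin_cases r' <;> simp [resR, resK] at h1 h2 ⊢ <;> omega
  · rintro ⟨x, y⟩
    have h : x % 5 = 0 ∨ x % 5 = 1 ∨ x % 5 = 2 ∨ x % 5 = 3 ∨ x % 5 = 4 := by omega
    rcases h with h | h | h | h | h
    · exact ⟨(0, (x / 5, y + 2 * (x / 5) - 1)), by simp [resR, resK]; omega⟩
    · exact ⟨(1, (x / 5, y + 2 * (x / 5))), by simp [resR, resK]; omega⟩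
    · exact ⟨(2, (x / 5, y + 2 * (x / 5))), by simp [resR, resK]; omega⟩
    · exact ⟨(3, (x / 5, y + 2 * (x / 5) + 1)), by simp [resR, resK]; omega⟩
    · exact ⟨(4, (x / 5, y + 2 * (x / 5) + 1)), by simp [resR, resK]; omega⟩

lemma QQ_mul {q : ℂ} (h0 : q ≠ 0) (hq : ‖q‖ < 1) (r s κ : ℤ) (h : s = 2 * r - 1 + 5 * κ) :
    ∑' p : ℤ × ℤ, WW q (5 * p.1 + r, p.2 - 2 * p.1 + κ) = QQ r q * QQ s q := by
  have hs := (ps_summable h0 hq).norm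
  have inj : ∀ r : ℤ, Function.Injective (fun k : ℤ => 5 * k + r) := by
    intro r a b h
    simp only at h
    omega
  have h1 := hs.comp_injective (inj r)
  have h2 := hs.comp_injective (inj s)
  unfold QQ
  rw [tsum_mul_tsum_of_summable_norm h1 h2]
  refine tsum_congr fun p => ?_
  simp only [WW]
  congr 2
  rw [h]; ring

lemma QQ_rel {q : ℂ} (h0 : q ≠ 0) (hq : ‖q‖ < 1) :
    (QQ 0 q + QQ 2 q) * (QQ 3 q + QQ 4 q) = - QQ 1 q ^ 2 := by
  have hw := WW_summable h0 hq
  have hs := (Equiv.summable_iff (Equiv.ofBijective _ pair_bij) (f := WW q)).2 hw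
  have hz := WW_zero h0
  rw [← (Equiv.ofBijective _ pair_bij).tsum_eq (WW q)] at hz
  have := hs.tsum_prod' (fun b => hs.prod_factor b)
  simp only [Function.comp_apply] at this
  rw [this, tsum_fintype, Fin.sum_univ_five] at hz
  have c0 := QQ_mul h0 hq 0 4 1 (by norm_num)
  have c1 := QQ_mul h0 hq 1 1 0 (by norm_num)
  have c2 := QQ_mul h0 hq 2 3 0 (by norm_num)
  have c3 := QQ_mul h0 hq 3 0 (-1) (by norm_num)
  have c4 := QQ_mul h0 hq 4 2 (-1) (by norm_num)
  simp only [Equiv.ofBijective_apply, resR, resK, Matrix.cons_val] at hz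
  rw [c0, c1, c2, c3, c4] at hz
  linear_combination hz

lemma QQ_rot {q z : ℂ} (hz : z ^ 5 = 1) (r c : ℤ)
    (h : 5 ∣ r * (3 * r - 1) - 2 * c) : QQ r (z * q) = z ^ c * QQ r q := by
  have hz0 : z ≠ 0 := by rintro rfl; norm_num at hz
  unfold QQ
  rw [← tsum_mul_left]
  refine tsum_congr fun k => ?_
  have t1 := two_tri (5 * k + r)
  obtain ⟨w, hw⟩ := h
  have e : ∃ v : ℤ, 5 * k + r + 3 * tri (5 * k + r) = c + 5 * v := by
    have : 2 * (5 * k + r + 3 * tri (5 * k + r)) - 2 * c = 5 * (w + 15 * k ^ 2 + 6 * k * r - k) := by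
      linear_combination 3 * t1 + hw
    generalize w + 15 * k ^ 2 + 6 * k * r - k = v at this
    exact ⟨v / 2, by omega⟩
  obtain ⟨v, hv⟩ := e
  simp only [ps]
  rw [mul_zpow]
  have : z ^ (5 * k + r + 3 * tri (5 * k + r)) = z ^ c := by
    rw [hv, zpow_add₀ hz0, zpow_mul]
    have : z ^ (5 : ℤ) = 1 := by exact_mod_cast hz
    rw [this, one_zpow, mul_one]
  rw [this]; ring

/-- First part. -/
noncomputable def XX (q : ℂ) : ℂ := QQ 0 q + QQ 2 q
/-- Third part. -/
noncomputable def ZZ (q : ℂ) : ℂ := QQ 3 q + QQ 4 q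

lemma root5 : ∃ z : ℂ, 1 + z + z ^ 2 + z ^ 3 + z ^ 4 = 0 := by
  have h := Complex.isPrimitiveRoot_exp 5 (by norm_num)
  refine ⟨Complex.exp (2 * Real.pi * Complex.I / (5 : ℕ)), ?_⟩
  have h2 := h.geom_sum_eq_zero (by norm_num)
  simp only [Finset.sum_range_succ, Finset.sum_range_zero, pow_zero, pow_one, zero_add] at h2
  exact h2

lemma pow5_of {z : ℂ} (hz : 1 + z + z ^ 2 + z ^ 3 + z ^ 4 = 0) : z ^ 5 = 1 := by
  linear_combination (z - 1) * hz

lemma norm_of_pow5 {z : ℂ} (hz : z ^ 5 = 1) : ‖z‖ = 1 :=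
  Complex.norm_eq_one_of_pow_eq_one hz (by norm_num)

lemma XX_rot {q z : ℂ} (hz : z ^ 5 = 1) : XX (z * q) = XX q := by
  unfold XX
  rw [QQ_rot hz 0 0 (by norm_num), QQ_rot hz 2 0 (by norm_num)]
  simp

lemma YY_rot {q z : ℂ} (hz : z ^ 5 = 1) : QQ 1 (z * q) = z * QQ 1 q := by
  rw [QQ_rot hz 1 1 (by norm_num)]
  simp

lemma ZZ_rot {q z : ℂ} (hz : z ^ 5 = 1) : ZZ (z * q) = z ^ 2 * ZZ q := by
  unfold ZZ
  rw [QQ_rot hz 3 2 (by norm_num), QQ_rot hz 4 2 (by norm_num), ← mul_add]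
  norm_cast

lemma ee_XYZ {q : ℂ} (h0 : q ≠ 0) (hq : ‖q‖ < 1) : ee q = XX q + QQ 1 q + ZZ q := by
  rw [ee_QQ h0 hq, XX, ZZ]; ring

lemma XZ_rel {q : ℂ} (h0 : q ≠ 0) (hq : ‖q‖ < 1) : XX q * ZZ q = - QQ 1 q ^ 2 := QQ_rel h0 hq

/-- Cofactor polynomial. -/
def cof (x y w : ℂ) : ℂ := x ^ 4 - x ^ 3 * y + 2 * x ^ 2 * y ^ 2 - 3 * x * y ^ 3 + 5 * y ^ 4
  - 3 * y ^ 3 * w + 2 * y ^ 2 * w ^ 2 - y * w ^ 3 + w ^ 4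

lemma norm_alg {x y w z : ℂ} (hz : 1 + z + z ^ 2 + z ^ 3 + z ^ 4 = 0) (h : x * w = -y ^ 2) :
    (x + z * y + z ^ 2 * w) * (x + z ^ 2 * y + (z ^ 2) ^ 2 * w) *
      (x + z ^ 3 * y + (z ^ 3) ^ 2 * w) * (x + z ^ 4 * y + (z ^ 4) ^ 2 * w) = cof x y w := by
  have h5 := pow5_of hz
  have e6 : z ^ 6 = z := by linear_combination z * h5
  have e8 : z ^ 8 = z ^ 3 := by linear_combination z ^ 3 * h5
  have e7 : z ^ 7 = z ^ 2 := by linear_combination z ^ 2 * h5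
  have a1 : (x + z * y + z ^ 2 * w) * (x + z ^ 4 * y + z ^ 3 * w) =
      x ^ 2 + y ^ 2 + w ^ 2 + (z + z ^ 4) * (x * y + y * w) + (z ^ 2 + z ^ 3) * (x * w) := by
    linear_combination (y ^ 2 + w ^ 2 + y * w * z) * h5
  have a2 : (x + z ^ 2 * y + z ^ 4 * w) * (x + z ^ 3 * y + z * w) =
      x ^ 2 + y ^ 2 + w ^ 2 + (z ^ 2 + z ^ 3) * (x * y + y * w) + (z + z ^ 4) * (x * w) := by
    linear_combination (y ^ 2 + w ^ 2 + y * w * z ^ 2) * h5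
  have s : z + z ^ 4 = -1 - (z ^ 2 + z ^ 3) := by linear_combination hz
  have m : (z ^ 2 + z ^ 3) ^ 2 = 1 - (z ^ 2 + z ^ 3) := by
    linear_combination (z + 2) * h5 + hz
  rw [s] at a1 a2
  have g : (x + z * y + z ^ 2 * w) * (x + z ^ 2 * y + (z ^ 2) ^ 2 * w) *
      (x + z ^ 3 * y + (z ^ 3) ^ 2 * w) * (x + z ^ 4 * y + (z ^ 4) ^ 2 * w) =
      ((x + z * y + z ^ 2 * w) * (x + z ^ 4 * y + z ^ 3 * w)) *
      ((x + z ^ 2 * y + z ^ 4 * w) * (x + z ^ 3 * y + z * w)) := by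
    have e1 : (z ^ 3) ^ 2 = z := by rw [← pow_mul]; exact e6
    have e2 : (z ^ 4) ^ 2 = z ^ 3 := by rw [← pow_mul]; exact e8
    rw [e1, e2]; ring
  rw [g, a1, a2, h]
  generalize z ^ 2 + z ^ 3 = b at m
  have g2 : (x ^ 2 + y ^ 2 + w ^ 2 + (-1 - b) * (x * y + y * w) + b * -y ^ 2) *
      (x ^ 2 + y ^ 2 + w ^ 2 + b * (x * y + y * w) + (-1 - b) * -y ^ 2) =
      (x ^ 2 + y ^ 2 + w ^ 2) ^ 2 - (x ^ 2 + y ^ 2 + w ^ 2) * (x * y + y * w)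
      + (x ^ 2 + y ^ 2 + w ^ 2) * y ^ 2 - (x * y + y * w) ^ 2 - y ^ 4
      - 3 * (x * y + y * w) * y ^ 2 := by
    linear_combination (-(x * y + y * w) ^ 2 - y ^ 4 - 2 * (x * y + y * w) * y ^ 2) * m
  rw [g2, cof]
  linear_combination (2 * (x * w - y ^ 2) - x * y - y * w - 2 * y ^ 2) * h

lemma CC_form {q : ℂ} (h0 : q ≠ 0) (hq : ‖q‖ < 1) :
    CC q = - QQ 1 q * cof (XX q) (QQ 1 q) (ZZ q) / ee (q ^ 5) := by
  obtain ⟨z, hz⟩ := root5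
  have h5 := pow5_of hz
  have z0 : z ≠ 0 := by rintro rfl; norm_num at h5
  have hn := norm_of_pow5 h5
  have key := ee_five hq hz hn
  have r : ∀ k : ℕ, ee (z ^ k * q) = XX q + z ^ k * QQ 1 q + (z ^ k) ^ 2 * ZZ q := by
    intro k
    have hk : (z ^ k) ^ 5 = 1 := by rw [← pow_mul, mul_comm, pow_mul, h5, one_pow]
    rw [ee_XYZ (mul_ne_zero (pow_ne_zero k z0) h0) (by rw [norm_mul, norm_of_pow5 hk, one_mul]; exact hq),
      XX_rot hk, YY_rot hk, ZZ_rot hk]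
  have r1 := r 1
  rw [pow_one] at r1
  have al := norm_alg hz (XZ_rel h0 hq)
  rw [← r1, ← r 2, ← r 3, ← r 4] at al
  have e1 := ee_ne hq
  have e5 := ee_ne (norm_pow_lt hq (m := 5) (by norm_num))
  rw [CC, div_eq_div_iff e1 e5]
  have y := QQ1 h0 hq
  rw [← al]
  nth_rewrite 1 [y]
  linear_combination - q * key

lemma Fp_form {q : ℂ} (h0 : q ≠ 0) (hq : ‖q‖ < 1) : ∃ A B C : ℂ, ∀ z : ℂ, z ^ 5 = 1 →
    DD (z * q) + 5 * CC (z * q) = A + z ^ 2 * B + z ^ 3 * C := by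
  set x := XX q with hx
  set y := QQ 1 q with hy
  set w := ZZ q with hw
  have rel : x * w = -y ^ 2 := XZ_rel h0 hq
  refine ⟨(x ^ 5 - 14 * y ^ 5 + w ^ 5) / ee (q ^ 5), (10 * x ^ 3 * y ^ 2 - 20 * y ^ 3 * w ^ 2) / ee (q ^ 5),
    (-20 * x ^ 2 * y ^ 3 + 10 * y ^ 2 * w ^ 3) / ee (q ^ 5), fun z hz => ?_⟩
  have z0 : z ≠ 0 := by rintro rfl; norm_num at hz
  have h0' := mul_ne_zero z0 h0
  have hq' : ‖z * q‖ < 1 := by rw [norm_mul, norm_of_pow5 hz, one_mul]; exact hq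
  rw [CC_form h0' hq', DD, ee_XYZ h0' hq', XX_rot hz, YY_rot hz, ZZ_rot hz, mul_pow z q 5, hz, one_mul,
    ← hx, ← hy, ← hw, mul_div_assoc', mul_div_assoc', mul_div_assoc', ← add_div, ← add_div, ← add_div]
  congr 1
  simp only [cof]
  linear_combination ((5) * w ^ 3 * z ^ 8 + (20) * y ^ 1 * w ^ 2 * z ^ 7 + (20) * y ^ 2 * w ^ 1 * z ^ 6 + (-10) * y ^ 3 * z ^ 5 + (10) * x ^ 1 * w ^ 2 * z ^ 6 + (30) * x ^ 1 * y ^ 1 * w ^ 1 * z ^ 5 + (20) * x ^ 1 * y ^ 2 * z ^ 4 + (10) * x ^ 2 * w ^ 1 * z ^ 4 + (20) * x ^ 2 * y ^ 1 * z ^ 3 + (5) * x ^ 3 * z ^ 2) * rel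
    + ((1) * w ^ 5 + (1) * w ^ 5 * z ^ 5 + (10) * y ^ 2 * w ^ 3 * z ^ 3 + (-20) * y ^ 3 * w ^ 2 * z ^ 2 + (-14) * y ^ 5) * hz

lemma Fm_form {q : ℂ} (h0 : q ≠ 0) (hq : ‖q‖ < 1) : ∃ A B C : ℂ, ∀ z : ℂ, z ^ 5 = 1 →
    DD (z * q) - 5 * CC (z * q) = A + z * B + z ^ 4 * C := by
  set x := XX q with hx
  set y := QQ 1 q with hy
  set w := ZZ q with hw
  have rel : x * w = -y ^ 2 := XZ_rel h0 hq
  refine ⟨(x ^ 5 + 36 * y ^ 5 + w ^ 5) / ee (q ^ 5), (10 * (x ^ 4 * y - 3 * y ^ 4 * w)) / ee (q ^ 5),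
    (10 * (-3 * x * y ^ 4 + y * w ^ 4)) / ee (q ^ 5), fun z hz => ?_⟩
  have z0 : z ≠ 0 := by rintro rfl; norm_num at hz
  have h0' := mul_ne_zero z0 h0
  have hq' : ‖z * q‖ < 1 := by rw [norm_mul, norm_of_pow5 hz, one_mul]; exact hq
  rw [CC_form h0' hq', DD, ee_XYZ h0' hq', XX_rot hz, YY_rot hz, ZZ_rot hz, mul_pow z q 5, hz, one_mul,
    ← hx, ← hy, ← hw, mul_div_assoc', mul_div_assoc', mul_div_assoc', ← add_div, ← add_div, ← sub_div]
  congr 1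
  simp only [cof]
  linear_combination ((5) * w ^ 3 * z ^ 8 + (20) * y ^ 1 * w ^ 2 * z ^ 7 + (20) * y ^ 2 * w ^ 1 * z ^ 6 + (-10) * y ^ 3 * z ^ 5 + (10) * x ^ 1 * w ^ 2 * z ^ 6 + (30) * x ^ 1 * y ^ 1 * w ^ 1 * z ^ 5 + (20) * x ^ 1 * y ^ 2 * z ^ 4 + (10) * x ^ 2 * w ^ 1 * z ^ 4 + (20) * x ^ 2 * y ^ 1 * z ^ 3 + (5) * x ^ 3 * z ^ 2) * rel
    + ((1) * w ^ 5 + (1) * w ^ 5 * z ^ 5 + (10) * y ^ 1 * w ^ 4 * z ^ 4 + (-30) * y ^ 4 * w ^ 1 * z ^ 1 + (36) * y ^ 5) * hz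

/-! ### Coefficient extraction -/

lemma hs_congr {f g : ℕ → ℂ} {s t : ℂ} (h : HasSum f s) (hf : ∀ n, g n = f n) (hs : t = s) :
    HasSum g t := by
  rw [hs, funext hf]; exact h

lemma coeff_unique {u : ℕ → ℂ} (h : ∀ q : ℂ, q ≠ 0 → ‖q‖ < 1 → HasSum (fun n => u n * q ^ n) 0)
    (n : ℕ) : u n = 0 := by
  set p : FormalMultilinearSeries ℂ ℂ ℂ :=
    FormalMultilinearSeries.ofScalars ℂ (fun n => if n = 0 then 0 else u (n - 1)) with hp
  have hf : HasFPowerSeriesAt (0 : ℂ → ℂ) p 0 := by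
    rw [hasFPowerSeriesAt_iff]
    filter_upwards [Metric.ball_mem_nhds (0 : ℂ) one_pos] with q hq
    have hq1 : ‖q‖ < 1 := by simpa using hq
    simp only [hp, FormalMultilinearSeries.coeff_ofScalars, smul_eq_mul, Pi.zero_apply]
    rcases eq_or_ne q 0 with rfl | h0
    · have : (fun n : ℕ => (0 : ℂ) ^ n * (if n = 0 then 0 else u (n - 1))) = fun _ => 0 := by
        funext n
        rcases n with _ | n <;> simp
      rw [this]; exact hasSum_zero
    · rw [← hasSum_nat_add_iff' 1]
      have := (h q h0 hq1).mul_left q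
      refine hs_congr this (fun n => ?_) (by simp)
      simp
      ring
  have := hf.eq_zero
  have h2 : p.coeff (n + 1) = 0 := by rw [this]; rfl
  rw [hp, FormalMultilinearSeries.coeff_ofScalars] at h2
  simpa using h2

/-- Coefficients of `f(q²)`. -/
noncomputable def half (u : ℕ → ℂ) (n : ℕ) : ℂ := if n % 2 = 0 then u (n / 2) else 0

lemma half_hasSum {u : ℕ → ℂ} {q s : ℂ} (h : HasSum (fun n => u n * (q ^ 2) ^ n) s) :
    HasSum (fun n => half u n * q ^ n) s := by
  have inj : Function.Injective (fun n : ℕ => 2 * n) := fun a b h => by simp at h; exact h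
  rw [← inj.hasSum_iff]
  · convert h using 2 with n
    simp [half, pow_mul]
  · intro x hx
    have : x % 2 ≠ 0 := fun h => hx ⟨x / 2, by simp; omega⟩
    simp [half, this]

/-- Coefficients of `q f(q)`. -/
noncomputable def shf (u : ℕ → ℂ) (n : ℕ) : ℂ := if n = 0 then 0 else u (n - 1)

lemma shf_hasSum {u : ℕ → ℂ} {q s : ℂ} (h : HasSum (fun n => u n * q ^ n) s) :
    HasSum (fun n => shf u n * q ^ n) (q * s) := by
  rw [← hasSum_nat_add_iff' 1]
  refine hs_congr (h.mul_left q) (fun n => ?_) (by simp [shf])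
  simp [shf]; ring

lemma hasSum_of_tsum_ne {f : ℕ → ℂ} {s : ℂ} (h : ∑' n, f n = s) (hs : s ≠ 0) : HasSum f s := by
  by_cases hf : Summable f
  · rw [← h]; exact hf.hasSum
  · rw [tsum_eq_zero_of_not_summable hf] at h
    exact absurd h.symm hs

lemma KK_form {q : ℂ} (h0 : q ≠ 0) (hq : ‖q‖ < 1) : ∃ A B C : ℂ, ∀ z : ℂ, z ^ 5 = 1 →
    5 * (phiNeg ((z * q) ^ 5) ^ 5 / phiNeg (z * q)) - 10 * CC (z * q) - 40 * CC ((z * q) ^ 2) =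
      A + z ^ 2 * B + z ^ 3 * C := by
  obtain ⟨A, B, C, h1⟩ := Fp_form h0 hq
  obtain ⟨A', B', C', h2⟩ := Fm_form (pow_ne_zero 2 h0) (norm_pow_lt hq two_ne_zero)
  refine ⟨A + 4 * A', B + 4 * B', C + 4 * C', fun z hz => ?_⟩
  have z0 : z ≠ 0 := by rintro rfl; norm_num at hz
  have h0' := mul_ne_zero z0 h0
  have hq' : ‖z * q‖ < 1 := by rw [norm_mul, norm_of_pow5 hz, one_mul]; exact hq
  have a := identA h0' hq'
  have b := h1 z hz
  have c := h2 (z ^ 2) (by rw [← pow_mul, mul_comm, pow_mul, hz, one_pow])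
  rw [← mul_pow] at c
  linear_combination a + b + 4 * c + 4 * z ^ 3 * C' * hz

lemma coeff_K {κ : ℕ → ℂ} {K : ℂ → ℂ}
    (hK : ∀ q : ℂ, q ≠ 0 → ‖q‖ < 1 → HasSum (fun n => κ n * q ^ n) (K q))
    (hf : ∀ q : ℂ, q ≠ 0 → ‖q‖ < 1 → ∃ A B C : ℂ, ∀ z : ℂ, z ^ 5 = 1 →
      K (z * q) = A + z ^ 2 * B + z ^ 3 * C) (m : ℕ) : κ (5 * m + 4) = 0 := by
  obtain ⟨z, hz⟩ := root5
  have h5 := pow5_of hz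
  have z0 : z ≠ 0 := by rintro rfl; norm_num at h5
  have key := coeff_unique (u := fun n => κ n * (1 + z * z ^ n + z ^ 2 * (z ^ 2) ^ n +
    z ^ 3 * (z ^ 3) ^ n + z ^ 4 * (z ^ 4) ^ n)) ?_ (5 * m + 4)
  · have e : ∀ k : ℕ, z ^ k * (z ^ k) ^ (5 * m + 4) = 1 := by
      intro k
      have : z ^ k * (z ^ k) ^ (5 * m + 4) = (z ^ 5) ^ (k * (m + 1)) := by ring
      rw [this, h5, one_pow]
    have e1 := e 1
    rw [pow_one] at e1
    simp only [e1, e 2, e 3, e 4] at key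
    linear_combination (1 / 5) * key
  · intro q h0 hq
    obtain ⟨A, B, C, h⟩ := hf q h0 hq
    have hk : ∀ k : ℕ, HasSum (fun n => κ n * (z ^ k * q) ^ n) (K (z ^ k * q)) := by
      intro k
      apply hK _ (mul_ne_zero (pow_ne_zero k z0) h0)
      rw [norm_mul, norm_pow, norm_of_pow5 h5, one_pow, one_mul]; exact hq
    have hs := ((((hk 0).add ((hk 1).mul_left z)).add ((hk 2).mul_left (z ^ 2))).add
      ((hk 3).mul_left (z ^ 3))).add ((hk 4).mul_left (z ^ 4))
    have p : ∀ k : ℕ, (z ^ k) ^ 5 = 1 := fun k => by rw [← pow_mul, mul_comm, pow_mul, h5, one_pow]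
    rw [h _ (p 0), h _ (p 1), h _ (p 2), h _ (p 3), h _ (p 4)] at hs
    refine hs_congr hs (fun n => ?_) ?_
    · simp only [mul_pow]
      ring
    · linear_combination -(A + B + C) * hz - B * (z + z ^ 4 + z ^ 2 * (z ^ 5 + 1)) * h5
        - C * (z ^ 3 + z ^ 2 * (z ^ 5 + 1) + z * (z ^ 10 + z ^ 5 + 1)) * h5

theorem main_aux (c a : ℕ → ℤ)
    (hc : ∀ q : ℂ, ‖q‖ < 1 →
      ∑' n : ℕ, (c n : ℂ) * q ^ n = qpoch (q ^ 5) (q ^ 5) ^ 5 / qpoch q q)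
    (ha : ∀ q : ℂ, ‖q‖ < 1 →
      ∑' n : ℕ, (a n : ℂ) * q ^ n = phiNeg (q ^ 5) ^ 5 / phiNeg q) :
    ∀ n : ℕ, a (20 * n + 14) = 10 * c (10 * n + 6) := by
  intro n
  set d := shf (fun n => (c n : ℂ)) with hd
  have hC : ∀ q : ℂ, ‖q‖ < 1 → HasSum (fun n => d n * q ^ n) (CC q) := by
    intro q hq
    have e1 := ee_ne hq
    have e5 := ee_ne (norm_pow_lt hq (m := 5) (by norm_num))
    have := hasSum_of_tsum_ne (hc q hq) (div_ne_zero (pow_ne_zero 5 e5) e1)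
    have := shf_hasSum this
    rw [CC, mul_div_assoc]
    exact this
  have hA : ∀ q : ℂ, ‖q‖ < 1 → HasSum (fun n => (a n : ℂ) * q ^ n) (phiNeg (q ^ 5) ^ 5 / phiNeg q) := by
    intro q hq
    have ph : ∀ q : ℂ, ‖q‖ < 1 → phiNeg q ≠ 0 := fun q hq =>
      div_ne_zero (pow_ne_zero 2 (ee_ne hq)) (ee_ne (norm_pow_lt hq two_ne_zero))
    exact hasSum_of_tsum_ne (ha q hq)
      (div_ne_zero (pow_ne_zero 5 (ph _ (norm_pow_lt hq (by norm_num)))) (ph q hq))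
  have hC2 : ∀ q : ℂ, ‖q‖ < 1 → HasSum (fun n => half d n * q ^ n) (CC (q ^ 2)) := fun q hq =>
    half_hasSum (hC _ (norm_pow_lt hq two_ne_zero))
  have hC4 : ∀ q : ℂ, ‖q‖ < 1 → HasSum (fun n => half (half d) n * q ^ n) (CC (q ^ 4)) := by
    intro q hq
    have := half_hasSum (hC2 _ (norm_pow_lt hq two_ne_zero))
    rwa [← pow_mul] at this
  have kK := coeff_K (κ := fun n => 5 * (a n : ℂ) - 10 * d n - 40 * half d n)
    (K := fun q => 5 * (phiNeg (q ^ 5) ^ 5 / phiNeg q) - 10 * CC q - 40 * CC (q ^ 2))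
    (fun q _ hq => by
      have := (((hA q hq).mul_left 5).sub ((hC q hq).mul_left 10)).sub ((hC2 q hq).mul_left 40)
      exact hs_congr this (fun n => by ring) rfl) (fun q h0 hq => KK_form h0 hq) (4 * n + 2)
  have kB := coeff_unique (u := fun n => d n + d n * (-1) ^ n - 2 * half d n - 4 * half (half d) n)
    (fun q h0 hq => by
      have := (((hC q hq).add (hC (-q) (by rwa [norm_neg]))).sub ((hC2 q hq).mul_left 2)).sub
        ((hC4 q hq).mul_left 4)
      refine hs_congr this (fun n => ?_) ?_
      · rw [neg_pow q]
        ring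
      · rw [identB h0 hq]; ring) (20 * n + 14)
  have e0 : 5 * (4 * n + 2) + 4 = 20 * n + 14 := by ring
  have e1 : half d (20 * n + 14) = d (10 * n + 7) := by
    simp only [half]
    rw [if_pos (by omega)]; congr 1; omega
  have e2 : half (half d) (20 * n + 14) = 0 := by
    rw [half, if_pos (by omega), half, if_neg (by omega)]
  have e3 : d (10 * n + 7) = c (10 * n + 6) := by
    simp [hd, shf]
  have e4 : (-1 : ℂ) ^ (20 * n + 14) = 1 := Even.neg_one_pow ⟨10 * n + 7, by ring⟩
  simp only [e0, e1] at kK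
  simp only [e1, e2, e4] at kB
  rw [e3] at kK kB
  have : (a (20 * n + 14) : ℂ) = 10 * c (10 * n + 6) := by
    linear_combination (1 / 5) * kK + kB
  exact_mod_cast this

theorem stmt_5 (c a : ℕ → ℤ)
    (hc : ∀ q : ℂ, ‖q‖ < 1 →
      ∑' n : ℕ, (c n : ℂ) * q ^ n = qpoch (q ^ 5) (q ^ 5) ^ 5 / qpoch q q)
    (ha : ∀ q : ℂ, ‖q‖ < 1 →
      ∑' n : ℕ, (a n : ℂ) * q ^ n = phiNeg (q ^ 5) ^ 5 / phiNeg q) :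
    ∀ n : ℕ, a (20 * n + 14) = 10 * c (10 * n + 6) := by
  exact main_aux c a hc ha
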